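/- arXiv:2502.16983 — 13 statements merged into one kernel-verified Lean document; each statement's English description precedes it below -/
import Mathlib

section
/- Let k and t be positive integers and let f be any function on binary vectors of length k that takes at least two distinct values. Then the optimal redundancy satisfies r_f(k,t) ≥ 2t; equivalently, every function-correcting code p : 𝔽₂^k → 𝔽₂^r for f correcting t errors has r ≥ 2t. -/
/-- The optimal redundancy `r_f(k,t)`: the least `r` for which there exists a
function-correcting code `p : 𝔽₂^k → 𝔽₂^r` for `f` correcting `t` errors. -/
noncomputable def optRedundancy {α : Type*} (k t : ℕ) (f : (Fin k → ZMod 2) → α) : ℕ :=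
  sInf {r : ℕ | ∃ p : (Fin k → ZMod 2) → (Fin r → ZMod 2),
    ∀ u v, f u ≠ f v → 2 * t + 1 ≤ hammingDist u v + hammingDist (p u) (p v)}

theorem aux_neighbor {α : Type*} (k : ℕ) (f : (Fin k → ZMod 2) → α)
    (hf : ∃ u v : Fin k → ZMod 2, f u ≠ f v) :
    ∃ (u : Fin k → ZMod 2) (i : Fin k) (x : ZMod 2), f u ≠ f (Function.update u i x) := by
  by_contra! h
  obtain ⟨u, v, huv⟩ := hf
  have key : ∀ s : Finset (Fin k), f u = f (s.piecewise v u) := by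
    intro s
    induction s using Finset.induction_on with
    | empty => simp
    | insert a s ha ih =>
      rw [Finset.piecewise_insert, ← h]
      exact ih
  apply huv
  simpa using key Finset.univ

theorem aux_bound {α : Type*} (k t : ℕ)
    (f : (Fin k → ZMod 2) → α) (hf : ∃ u v : Fin k → ZMod 2, f u ≠ f v)
    (r : ℕ) (p : (Fin k → ZMod 2) → (Fin r → ZMod 2))
    (hp : ∀ u v, f u ≠ f v → 2 * t + 1 ≤ hammingDist u v + hammingDist (p u) (p v)) :
    2 * t ≤ r := by
  obtain ⟨u, i, x, h⟩ := aux_neighbor k f hf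
  have h1 := hp _ _ h
  have h2 : hammingDist (p u) (p (Function.update u i x)) ≤ r := by
    simpa using hammingDist_le_card_fintype (x := p u) (y := p (Function.update u i x))
  have h3 : hammingDist u (Function.update u i x) ≤ 1 := by
    unfold hammingDist
    refine (Finset.card_le_card (t := {i}) ?_).trans (by simp)
    intro j hj
    by_contra hne
    simp at hj hne
    exact hj (by simp [hne])
  omega

theorem aux_exists {α : Type*} (k t : ℕ) (f : (Fin k → ZMod 2) → α) :
    ∃ (r : ℕ) (p : (Fin k → ZMod 2) → (Fin r → ZMod 2)),
      ∀ u v, f u ≠ f v → 2 * t + 1 ≤ hammingDist u v + hammingDist (p u) (p v) := by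
  refine ⟨k * (2 * t + 1), fun u i => u (finProdFinEquiv.symm i).1, ?_⟩
  intro u v h
  have hne : u ≠ v := fun e => h (by rw [e])
  obtain ⟨i, hi⟩ := Function.ne_iff.mp hne
  refine le_trans ?_ (Nat.le_add_left _ _)
  unfold hammingDist
  have := Finset.card_le_card_of_injOn (s := (Finset.univ : Finset (Fin (2 * t + 1))))
    (t := Finset.univ.filter fun j : Fin (k * (2 * t + 1)) =>
      u (finProdFinEquiv.symm j).1 ≠ v (finProdFinEquiv.symm j).1)
    (fun j => finProdFinEquiv (i, j))
    (by
      intro j _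
      rw [Finset.mem_coe, Finset.mem_filter]
      refine ⟨Finset.mem_univ _, ?_⟩
      rw [Equiv.symm_apply_apply]
      exact hi)
    (by
      intro a _ b _ hab
      exact (Prod.mk.inj (finProdFinEquiv.injective hab)).2)
  rw [Finset.card_univ, Fintype.card_fin] at this
  exact this

theorem stmt_0 {α : Type*} (k t : ℕ) (hk : 0 < k) (ht : 0 < t)
    (f : (Fin k → ZMod 2) → α) (hf : ∃ u v : Fin k → ZMod 2, f u ≠ f v) :
    2 * t ≤ optRedundancy k t f ∧
      ∀ (r : ℕ) (p : (Fin k → ZMod 2) → (Fin r → ZMod 2)),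
        (∀ u v, f u ≠ f v → 2 * t + 1 ≤ hammingDist u v + hammingDist (p u) (p v)) →
        2 * t ≤ r := by
  refine ⟨?_, fun r p hp => aux_bound k t f hf r p hp⟩
  obtain ⟨p, hp⟩ := Nat.sInf_mem (s := {r : ℕ | ∃ p : (Fin k → ZMod 2) → (Fin r → ZMod 2),
    ∀ u v, f u ≠ f v → 2 * t + 1 ≤ hammingDist u v + hammingDist (p u) (p v)})
    (aux_exists k t f)
  exact aux_bound k t f hf _ p hp
end

section
/- Let M and r be positive integers and let D be an M×M matrix of natural numbers. Suppose there exist vectors p_1, …, p_M in 𝔽₂^r with d(p_i,p_j) ≥ D_{ij} for all i,j ∈ [M]. If M is even, then r ≥ (4/M²)·∑_{1≤i<j≤M} D_{ij}; if M is odd, then r ≥ (4/(M²−1))·∑_{1≤i<j≤M} D_{ij}. -/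
theorem aux_sym (M : ℕ) (f : Fin M → Fin M → ℤ) (hs : ∀ i j, f i j = f j i) (h0 : ∀ i, f i i = 0) :
    ∑ i, ∑ j, f i j = 2 * ∑ i, ∑ j, (if i < j then f i j else 0) := by
  have h : ∀ i j, f i j = (if i < j then f i j else 0) + (if j < i then f j i else 0) := by
    intro i j
    rcases lt_trichotomy i j with h | h | h
    · simp [h, h.not_gt]
    · subst h; simp [h0]
    · simp [h, h.not_gt, hs i j]
  have h2 : ∑ i, ∑ j, f i j = ∑ i, ∑ j, ((if i < j then f i j else 0) + (if j < i then f j i else 0)) :=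
    Finset.sum_congr rfl fun i _ => Finset.sum_congr rfl fun j _ => h i j
  rw [h2]
  simp only [Finset.sum_add_distrib]
  rw [Finset.sum_comm (f := fun i j => if j < i then f j i else 0)]
  ring

theorem aux_col (M : ℕ) (x : Fin M → ZMod 2) :
    ∃ B : ℤ, 4 * ∑ i, ∑ j, (if i < j then (if x i ≠ x j then (1 : ℤ) else 0) else 0)
      = (M : ℤ) ^ 2 - (M - 2 * B) ^ 2 := by
  refine ⟨∑ i, (if x i = 0 then (1 : ℤ) else 0), ?_⟩
  set b : Fin M → ℤ := fun i => if x i = 0 then (1 : ℤ) else 0 with hb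
  have hf : ∀ i j, (if x i ≠ x j then (1 : ℤ) else 0) = b i + b j - 2 * (b i * b j) := by
    intro i j
    simp only [hb]
    generalize x i = u
    generalize x j = v
    revert u v
    decide
  have h := aux_sym M (fun i j => if x i ≠ x j then (1 : ℤ) else 0)
    (fun i j => by simp only [ne_comm]) (fun i => by simp)
  have h2 : ∑ i, ∑ j, (if x i ≠ x j then (1 : ℤ) else 0)
      = 2 * M * (∑ i, b i) - 2 * (∑ i, b i) ^ 2 := by
    simp only [hf, Finset.sum_sub_distrib, Finset.sum_add_distrib, ← Finset.mul_sum,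
      ← Finset.sum_mul, Finset.sum_const, Finset.card_univ, Fintype.card_fin, nsmul_eq_mul]
    ring
  change ∑ i, ∑ j, (if x i ≠ x j then (1 : ℤ) else 0) = _ at h
  linarith

theorem aux_main (M r : ℕ) (D : Matrix (Fin M) (Fin M) ℕ) (p : Fin M → (Fin r → ZMod 2))
    (hp : ∀ i j : Fin M, D i j ≤ hammingDist (p i) (p j)) (c : ℤ)
    (hc : ∀ B : ℤ, (M : ℤ) ^ 2 - (M - 2 * B) ^ 2 ≤ c) :
    4 * ∑ i : Fin M, ∑ j : Fin M, (if i < j then (D i j : ℤ) else 0) ≤ r * c := by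
  have h1 : ∑ i : Fin M, ∑ j : Fin M, (if i < j then (D i j : ℤ) else 0) ≤
      ∑ i : Fin M, ∑ j : Fin M, ∑ k : Fin r,
        (if i < j then (if p i k ≠ p j k then (1 : ℤ) else 0) else 0) := by
    refine Finset.sum_le_sum fun i _ => Finset.sum_le_sum fun j _ => ?_
    split_ifs with h
    · have := hp i j
      rw [hammingDist, Finset.card_filter] at this
      exact_mod_cast this
    · simp
  have h2 : ∑ i : Fin M, ∑ j : Fin M, ∑ k : Fin r,
        (if i < j then (if p i k ≠ p j k then (1 : ℤ) else 0) else 0) =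
      ∑ k : Fin r, ∑ i : Fin M, ∑ j : Fin M, 
        (if i < j then (if p i k ≠ p j k then (1 : ℤ) else 0) else 0) := by
    rw [Finset.sum_comm]
    conv_rhs => rw [Finset.sum_comm]
    rw [Finset.sum_comm]
    exact Finset.sum_congr rfl fun i _ => Finset.sum_comm
  have h3 : 4 * ∑ k : Fin r, ∑ i : Fin M, ∑ j : Fin M, 
        (if i < j then (if p i k ≠ p j k then (1 : ℤ) else 0) else 0) ≤ ∑ k : Fin r, c := by
    rw [Finset.mul_sum]
    refine Finset.sum_le_sum fun k _ => ?_
    obtain ⟨B, hB⟩ := aux_col M (fun i => p i k)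
    exact hB.le.trans (hc B)
  simp only [Finset.sum_const, Finset.card_univ, Fintype.card_fin, nsmul_eq_mul] at h3
  linarith

theorem stmt_1 (M r : ℕ) (hM : 0 < M) (hr : 0 < r)
    (D : Matrix (Fin M) (Fin M) ℕ)
    (p : Fin M → (Fin r → ZMod 2))
    (hp : ∀ i j : Fin M, D i j ≤ hammingDist (p i) (p j)) :
    (Even M →
      (4 / (M : ℝ) ^ 2) * ∑ i : Fin M, ∑ j : Fin M, (if i < j then (D i j : ℝ) else 0)
        ≤ (r : ℝ)) ∧
    (Odd M →
      (4 / ((M : ℝ) ^ 2 - 1)) * ∑ i : Fin M, ∑ j : Fin M, (if i < j then (D i j : ℝ) else 0)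
        ≤ (r : ℝ)) := by
  constructor
  · intro _
    have h := aux_main M r D p hp ((M : ℤ) ^ 2) (fun B => by nlinarith [sq_nonneg ((M : ℤ) - 2 * B)])
    have h' : 4 * ∑ i : Fin M, ∑ j : Fin M, (if i < j then (D i j : ℝ) else 0)
        ≤ r * (M : ℝ) ^ 2 := by exact_mod_cast h
    have : (0 : ℝ) < (M : ℝ) ^ 2 := by positivity
    rw [div_mul_eq_mul_div, div_le_iff₀ this]
    exact h'
  · intro ho
    have h := aux_main M r D p hp ((M : ℤ) ^ 2 - 1) (fun B => by
      obtain ⟨m, rfl⟩ := ho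
      have : ((2 * m + 1 : ℕ) : ℤ) - 2 * B ≠ 0 := by omega
      have := Int.one_le_abs this
      have := (one_le_sq_iff_one_le_abs _).2 this
      linarith)
    have h' : 4 * ∑ i : Fin M, ∑ j : Fin M, (if i < j then (D i j : ℝ) else 0)
        ≤ r * ((M : ℝ) ^ 2 - 1) := by exact_mod_cast h
    rcases (show M = 1 ∨ 1 < M by omega) with h1 | h1
    · subst h1; simp
    have : (0 : ℝ) < (M : ℝ) ^ 2 - 1 := by
      have : (1 : ℝ) < M := by exact_mod_cast h1
      nlinarith
    rw [div_mul_eq_mul_div, div_le_iff₀ this]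
    exact h'
end

section
/- For all natural numbers M and D with D ≥ 10 and M ≤ D², there exist a natural number r with r ≤ (2D−2)/(1 − 2·√(ln D / D)) and binary vectors p_1, …, p_M of length r whose pairwise Hamming distances are all at least D. -/
lemma ball_bound (r D : ℕ) (t : ℝ) (ht : 0 ≤ t) (y : Fin r → ZMod 2) :
    ((Finset.univ.filter (fun x : Fin r → ZMod 2 => hammingDist y x < D)).card : ℝ) *
      Real.exp (t * ((r : ℝ) - 2 * ((D : ℝ) - 1))) ≤ 2 ^ r * Real.exp (r * (t ^ 2 / 2)) := by
  classical
  set f : (Fin r → ZMod 2) → ℝ := fun x =>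
    ∏ i, (if y i ≠ x i then Real.exp (-t) else Real.exp t) with hf
  have hfx : ∀ x, f x = Real.exp (t * ((r : ℝ) - 2 * (hammingDist y x : ℝ))) := by
    intro x
    have h1 : f x = ∏ i, Real.exp (t + (if y i ≠ x i then (-2 * t) else 0)) := by
      rw [hf]
      refine Finset.prod_congr rfl fun i _ => ?_
      split_ifs
      · congr 1; ring
      · simp
    rw [h1, ← Real.exp_sum, Finset.sum_add_distrib, ← Finset.sum_filter]
    congr 1
    simp only [Finset.sum_const, hammingDist, Finset.card_univ, Fintype.card_fin, nsmul_eq_mul]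
    ring
  have htot : ∑ x, f x = (2 * Real.cosh t) ^ r := by
    have h := (Finset.prod_univ_sum (fun _ : Fin r => (Finset.univ : Finset (ZMod 2)))
      (fun i b => (if y i ≠ b then Real.exp (-t) else Real.exp t)))
    rw [Fintype.piFinset_univ] at h
    rw [hf, ← h]
    have h2 : ∀ a : ZMod 2, ∑ b : ZMod 2, (if a ≠ b then Real.exp (-t) else Real.exp t)
        = 2 * Real.cosh t := by
      intro a
      rw [Real.cosh_eq]
      have hs : ∀ g : ZMod 2 → ℝ, ∑ b, g b = g 0 + g 1 := fun g => Fin.sum_univ_two g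
      rw [hs]
      have ha : a = 0 ∨ a = 1 := by revert a; decide
      rcases ha with rfl | rfl <;> simp <;> ring
    rw [Finset.prod_congr rfl (fun i _ => h2 (y i))]
    simp
  calc _ = ∑ x ∈ Finset.univ.filter (fun x : Fin r → ZMod 2 => hammingDist y x < D),
        Real.exp (t * ((r : ℝ) - 2 * ((D : ℝ) - 1))) := by simp
    _ ≤ ∑ x ∈ Finset.univ.filter (fun x : Fin r → ZMod 2 => hammingDist y x < D), f x := by
        refine Finset.sum_le_sum fun x hx => ?_
        rw [hfx, Real.exp_le_exp]
        have hx' : hammingDist y x + 1 ≤ D := by simpa using hx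
        have : (hammingDist y x : ℝ) + 1 ≤ D := by exact_mod_cast hx'
        apply mul_le_mul_of_nonneg_left _ ht
        linarith
    _ ≤ ∑ x, f x := by
        refine Finset.sum_le_sum_of_subset_of_nonneg (Finset.subset_univ _) fun x _ _ => ?_
        rw [hfx]; positivity
    _ = 2 ^ r * (Real.cosh t) ^ r := by rw [htot, mul_pow]
    _ ≤ 2 ^ r * (Real.exp (t ^ 2 / 2)) ^ r := by
        have := Real.cosh_le_exp_half_sq t
        have := Real.cosh_pos t
        gcongr
    _ = _ := by rw [← Real.exp_nat_mul]

lemma greedy (r D N : ℕ) (hD : D ≠ 0)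
    (h : ∀ y : Fin r → ZMod 2,
      (Finset.univ.filter (fun x : Fin r → ZMod 2 => hammingDist y x < D)).card * N ≤ 2 ^ r) :
    ∀ m ≤ N, ∃ s : Finset (Fin r → ZMod 2), s.card = m ∧
      ∀ x ∈ s, ∀ y ∈ s, x ≠ y → D ≤ hammingDist x y := by
  classical
  intro m
  induction m with
  | zero => intro _; exact ⟨∅, by simp⟩
  | succ m ih =>
    intro hm
    obtain ⟨s, hs, hp⟩ := ih (by omega)
    set U := s.biUnion (fun y =>
      Finset.univ.filter (fun x : Fin r → ZMod 2 => hammingDist y x < D)) with hU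
    have hUc : U.card * N ≤ m * 2 ^ r := by
      calc U.card * N ≤ (∑ y ∈ s,
            (Finset.univ.filter (fun x : Fin r → ZMod 2 => hammingDist y x < D)).card) * N :=
            Nat.mul_le_mul_right _ Finset.card_biUnion_le
        _ = ∑ y ∈ s, (Finset.univ.filter
              (fun x : Fin r → ZMod 2 => hammingDist y x < D)).card * N := Finset.sum_mul ..
        _ ≤ ∑ y ∈ s, 2 ^ r := Finset.sum_le_sum fun y _ => h y
        _ = m * 2 ^ r := by simp [hs]
    have hlt : U.card < 2 ^ r := by
      by_contra hcon
      push Not at hcon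
      have h1 : 2 ^ r * (m + 1) ≤ U.card * N := Nat.mul_le_mul hcon hm
      have h2 : 0 < 2 ^ r := by positivity
      nlinarith
    have hex : ∃ x, x ∉ U := by
      by_contra hcon
      push Not at hcon
      have : U = Finset.univ := Finset.eq_univ_iff_forall.mpr hcon
      rw [this] at hlt
      simp [ZMod.card] at hlt
    obtain ⟨x, hx⟩ := hex
    have hx' : ∀ y ∈ s, D ≤ hammingDist y x := by
      intro y hy
      by_contra hcon
      exact hx (by simp only [hU, Finset.mem_biUnion, Finset.mem_filter, Finset.mem_univ, true_and]
                   exact ⟨y, hy, by omega⟩)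
    have hxs : x ∉ s := fun hxs => hD (by simpa using hx' x hxs)
    refine ⟨insert x s, by rw [Finset.card_insert_of_notMem hxs, hs], ?_⟩
    intro a ha b hb hab
    rw [Finset.mem_insert] at ha hb
    rcases ha with rfl | ha <;> rcases hb with rfl | hb
    · exact absurd rfl hab
    · rw [hammingDist_comm]; exact hx' b hb
    · exact hx' a ha
    · exact hp a ha b hb hab

theorem stmt_3 (M D : ℕ) (hD : 10 ≤ D) (hM : M ≤ D ^ 2) :
    ∃ r : ℕ, (r : ℝ) ≤ (2 * (D : ℝ) - 2) / (1 - 2 * Real.sqrt (Real.log D / D)) ∧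
      ∃ p : Fin M → (Fin r → ZMod 2),
        ∀ i j : Fin M, i ≠ j → D ≤ hammingDist (p i) (p j) := by
  have hDr : (10 : ℝ) ≤ D := by exact_mod_cast hD
  have hD0 : (0 : ℝ) < D := by linarith
  set L := Real.log D with hL
  have hL1 : 1 ≤ L := by
    rw [hL, Real.le_log_iff_exp_le hD0]
    linarith [Real.exp_one_lt_d9]
  have hLD : 4 * L < D := by
    have h10 : Real.log 10 < 2.5 := by
      rw [Real.log_lt_iff_lt_exp (by norm_num)]
      have h1 := Real.exp_one_gt_d9
      have h2 : Real.exp 2.5 ^ 2 = Real.exp 1 ^ 5 := by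
        rw [← Real.exp_nat_mul, ← Real.exp_nat_mul]; norm_num
      have h3 : (2.7 : ℝ) ^ 5 ≤ Real.exp 1 ^ 5 := by gcongr; linarith
      have h4 := Real.exp_pos 2.5
      rw [← h2] at h3
      by_contra hcon
      push Not at hcon
      have h5 : Real.exp 2.5 ^ 2 ≤ 10 ^ 2 := by gcongr
      have h6 : (10 : ℝ) ^ 2 < 2.7 ^ 5 := by norm_num
      linarith
    have h1 : L = Real.log 10 + Real.log (D / 10) := by
      rw [← Real.log_mul (by norm_num) (by positivity)]
      rw [hL]; congr 1; field_simp
    have h2 := Real.log_le_sub_one_of_pos (show (0 : ℝ) < D / 10 by positivity)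
    linarith
  set e := Real.sqrt (L / D) with he
  have he2 : e ^ 2 * D = L := by
    rw [he, Real.sq_sqrt (by positivity)]; field_simp
  have he0 : 0 < e := Real.sqrt_pos.mpr (by positivity)
  have heh : 2 * e < 1 := by
    by_contra hcon
    push Not at hcon
    have h1 : 1 ≤ 4 * e ^ 2 := by nlinarith
    nlinarith
  set R := (2 * (D : ℝ) - 2) / (1 - 2 * e) with hR
  have hRe : R * (1 - 2 * e) = 2 * D - 2 := by
    rw [hR]; field_simp [show (1 - 2 * e) ≠ 0 by linarith]
  have hRD : 2 * (D : ℝ) - 2 ≤ R := by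
    rw [hR, le_div_iff₀ (by linarith)]; nlinarith
  have hkey : 1 ≤ e * (D - 2) := by
    have : 1 ≤ (e * (D - 2)) ^ 2 := by
      have h1 : 1 ≤ e ^ 2 * D := by linarith
      have h2 : (D : ℝ) ≤ (D - 2) ^ 2 := by nlinarith
      rw [mul_pow]; nlinarith [sq_nonneg e]
    have h3 : 0 ≤ e * (D - 2) := mul_nonneg he0.le (by linarith)
    nlinarith
  have hkey2 : 1 ≤ e * (R - D) := hkey.trans (mul_le_mul_of_nonneg_left (by linarith) he0.le)
  set r := ⌊R⌋₊ with hr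
  have hrR : (r : ℝ) ≤ R := Nat.floor_le (by linarith)
  have hRr : R < r + 1 := Nat.lt_floor_add_one R
  refine ⟨r, hrR, ?_⟩
  have hr0 : (0 : ℝ) < r := by linarith
  set d := (r : ℝ) - 2 * ((D : ℝ) - 1) with hd
  have hdl : 2 * e * R - 1 ≤ d := by linarith
  have heR : 1 ≤ 2 * e * R := by nlinarith
  have hd0 : 0 ≤ d := by linarith
  have hd2 : 4 * L * r ≤ d ^ 2 := by
    have h1 : (2 * e * R - 1) ^ 2 ≤ d ^ 2 := by gcongr
    have h2 : 4 * L * r ≤ 4 * L * R := by gcongr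
    have h3 : 4 * L * R ≤ (2 * e * R - 1) ^ 2 := by
      have : 0 ≤ 4 * e * R * (e * (R - D) - 1) := by
        apply mul_nonneg
        · nlinarith
        · linarith
      rw [← he2]; nlinarith
    linarith
  have hball : ∀ y : Fin r → ZMod 2,
      (Finset.univ.filter (fun x : Fin r → ZMod 2 => hammingDist y x < D)).card * D ^ 2
        ≤ 2 ^ r := by
    intro y
    have hb := ball_bound r D (d / r) (by positivity) y
    rw [← hd] at hb
    set V := (Finset.univ.filter (fun x : Fin r → ZMod 2 => hammingDist y x < D)).card
    have hexp : (D : ℝ) ^ 2 * Real.exp (r * ((d / r) ^ 2 / 2)) ≤ Real.exp (d / r * d) := by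
      have : (D : ℝ) ^ 2 = Real.exp (2 * L) := by
        rw [two_mul, Real.exp_add, hL, Real.exp_log hD0, sq]
      rw [this, ← Real.exp_add, Real.exp_le_exp]
      have h1 : r * ((d / r) ^ 2 / 2) = d ^ 2 / r / 2 := by field_simp
      have h2 : d / r * d = d ^ 2 / r := by ring
      have h3 : 4 * L ≤ d ^ 2 / r := by rw [le_div_iff₀ hr0]; exact hd2
      rw [h1, h2]; linarith
    have hE := Real.exp_pos (r * ((d / r) ^ 2 / 2))
    have : (V : ℝ) * D ^ 2 ≤ 2 ^ r := by
      refine le_of_mul_le_mul_right ?_ hE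
      calc (V : ℝ) * D ^ 2 * Real.exp (r * ((d / r) ^ 2 / 2))
          = V * (D ^ 2 * Real.exp (r * ((d / r) ^ 2 / 2))) := by ring
        _ ≤ V * Real.exp (d / r * d) := by gcongr
        _ ≤ _ := hb
    exact_mod_cast this
  obtain ⟨s, hs, hp⟩ := greedy r D (D ^ 2) (by omega) hball M hM
  refine ⟨fun i => (s.equivFinOfCardEq hs).symm i, fun i j hij => ?_⟩
  refine hp _ (Subtype.prop _) _ (Subtype.prop _) fun heq => hij ?_
  exact (s.equivFinOfCardEq hs).symm.injective (Subtype.ext heq)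
end

section
/- For all positive integers k and t, the optimal redundancy r_wt(k,t) of function-correcting codes for the Hamming weight function wt equals the least natural number r for which there exist binary vectors p_0, p_1, …, p_k of length r such that |i − j| + d(p_i, p_j) ≥ 2t+1 for all 0 ≤ i ≠ j ≤ k. -/
theorem stmt_4 (k t : ℕ) (hk : 0 < k) (ht : 0 < t) :
    optRedundancy k t (fun u => hammingNorm u) =
      sInf {r : ℕ | ∃ p : Fin (k + 1) → (Fin r → ZMod 2),
        ∀ i j : Fin (k + 1), i ≠ j →
          2 * t + 1 ≤ Nat.dist (i : ℕ) (j : ℕ) + hammingDist (p i) (p j)} := by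
  unfold optRedundancy
  congr 1
  ext r
  simp only [Set.mem_ofPred_eq]
  constructor
  · rintro ⟨p, hp⟩
    let w : Fin (k + 1) → Fin k → ZMod 2 := fun i a => if (a : ℕ) < i then 1 else 0
    have hn : ∀ i : Fin (k + 1), hammingNorm (w i) = i := by
      intro i
      have h1 : (Finset.univ.filter fun a : Fin k => w i a ≠ 0).map Fin.valEmbedding
          = Finset.range i := by
        ext x
        simp only [Finset.mem_map, Finset.mem_filter, Finset.mem_univ, true_and,
          Fin.valEmbedding_apply, Finset.mem_range, w]
        constructor
        · rintro ⟨a, ha, rfl⟩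
          by_contra h
          simp [h] at ha
        · intro h
          exact ⟨⟨x, by have := i.2; omega⟩, by simp [h], rfl⟩
      unfold hammingNorm
      rw [← Finset.card_map Fin.valEmbedding, h1, Finset.card_range]
    have hd : ∀ i j : Fin (k + 1), hammingDist (w i) (w j) ≤ Nat.dist i j := by
      intro i j
      have h1 : (Finset.univ.filter fun a : Fin k => w i a ≠ w j a).map Fin.valEmbedding
          ⊆ Finset.Ico (min (i : ℕ) j) (max (i : ℕ) j) := by
        intro x
        simp only [Finset.mem_map, Finset.mem_filter, Finset.mem_univ, true_and,
          Fin.valEmbedding_apply, Finset.mem_Ico, w]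
        rintro ⟨a, ha, rfl⟩
        by_cases h : (a : ℕ) < i <;> by_cases h' : (a : ℕ) < j <;> simp [h, h'] at ha <;> omega
      have h2 := Finset.card_le_card h1
      rw [Finset.card_map, Nat.card_Ico] at h2
      unfold hammingDist Nat.dist
      omega
    refine ⟨fun i => p (w i), fun i j hij => ?_⟩
    have h := hp (w i) (w j) (by rw [hn, hn]; exact fun h => hij (Fin.ext h))
    have := hd i j
    dsimp only
    omega
  · rintro ⟨q, hq⟩
    have hb : ∀ u : Fin k → ZMod 2, hammingNorm u < k + 1 := by
      intro u
      have := hammingNorm_le_card_fintype (x := u)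
      rw [Fintype.card_fin] at this
      omega
    refine ⟨fun u => q ⟨hammingNorm u, hb u⟩, fun u v huv => ?_⟩
    have h := hq ⟨hammingNorm u, hb u⟩ ⟨hammingNorm v, hb v⟩
      (fun h => huv (congrArg Fin.val h))
    have h1 := hammingDist_triangle u v 0
    have h2 := hammingDist_triangle v u 0
    rw [hammingDist_comm v u] at h2
    simp only [hammingDist_zero_right] at h1 h2
    unfold Nat.dist at h
    dsimp only at h ⊢
    omega
end

section
/- For all positive integers k, t, T, the optimal redundancy r_{Δ_T}(k,t) of function-correcting codes for the Hamming weight distribution function Δ_T equals the least natural number r for which there exist binary vectors p_0, p_1, …, p_k of length r such that |i − j| + d(p_i, p_j) ≥ 2t+1 for all 0 ≤ i ≠ j ≤ k with ⌊i/T⌋ ≠ ⌊j/T⌋. -/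
/-- The vector whose first `i` coordinates are one and the others zero. -/
def stepVec (k i : ℕ) : Fin k → ZMod 2 := fun x => if (x : ℕ) < i then 1 else 0

lemma hammingNorm_stepVec (k i : ℕ) (h : i ≤ k) : hammingNorm (stepVec k i) = i := by
  unfold hammingNorm stepVec
  have : (Finset.univ.filter fun x : Fin k => (if (x : ℕ) < i then (1 : ZMod 2) else 0) ≠ 0)
      = Finset.univ.filter fun x : Fin k => (x : ℕ) < i := by
    ext x
    simp
  rw [this, Fin.card_filter_val_lt]
  omega

lemma hammingDist_stepVec_le (k i j : ℕ) :
    hammingDist (stepVec k i) (stepVec k j) ≤ Nat.dist i j := by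
  unfold hammingDist
  have h : ((Finset.univ.filter fun x : Fin k => stepVec k i x ≠ stepVec k j x).map
      Fin.valEmbedding) ⊆ Finset.Ico (min i j) (max i j) := by
    intro y hy
    simp only [Finset.mem_map, Finset.mem_filter, Finset.mem_univ, true_and] at hy
    obtain ⟨x, hx, rfl⟩ := hy
    simp only [Fin.valEmbedding_apply, Finset.mem_Ico]
    unfold stepVec at hx
    split_ifs at hx <;> first | omega | exact absurd rfl hx
  have h2 := Finset.card_le_card h
  rw [Finset.card_map, Nat.card_Ico] at h2
  refine h2.trans ?_
  unfold Nat.dist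
  omega

lemma dist_hammingNorm_le (k : ℕ) (u v : Fin k → ZMod 2) :
    Nat.dist (hammingNorm u) (hammingNorm v) ≤ hammingDist u v := by
  have h1 := hammingDist_triangle u v 0
  have h2 := hammingDist_triangle v u 0
  rw [hammingDist_comm v u] at h2
  simp only [hammingDist_zero_right] at h1 h2
  unfold Nat.dist
  omega

theorem stmt_5 (k t T : ℕ) (hk : 0 < k) (ht : 0 < t) (hT : 0 < T) :
    optRedundancy k t (fun u => hammingNorm u / T) =
      sInf {r : ℕ | ∃ p : Fin (k + 1) → (Fin r → ZMod 2),
        ∀ i j : Fin (k + 1), i ≠ j → (i : ℕ) / T ≠ (j : ℕ) / T →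
          2 * t + 1 ≤ Nat.dist (i : ℕ) (j : ℕ) + hammingDist (p i) (p j)} := by
  unfold optRedundancy
  congr 1
  ext r
  simp only [Set.mem_setOf_eq]
  constructor
  · rintro ⟨p, hp⟩
    refine ⟨fun i => p (stepVec k i), fun i j _ hij => ?_⟩
    have h := hp (stepVec k i) (stepVec k j) (by
      rw [hammingNorm_stepVec k i (by omega), hammingNorm_stepVec k j (by omega)]
      exact hij)
    have h2 := hammingDist_stepVec_le k i j
    dsimp only
    omega
  · rintro ⟨p, hp⟩
    have hb : ∀ u : Fin k → ZMod 2, hammingNorm u < k + 1 := fun u => by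
      have := hammingNorm_le_card_fintype (x := u)
      simp only [Fintype.card_fin] at this
      omega
    refine ⟨fun u => p ⟨hammingNorm u, hb u⟩, fun u v huv => ?_⟩
    have h := hp ⟨hammingNorm u, hb u⟩ ⟨hammingNorm v, hb v⟩ (by
      intro he
      apply huv
      rw [Fin.mk.injEq] at he
      rw [he]) huv
    have h2 := dist_hammingNorm_le k u v
    dsimp only at h ⊢
    omega
end

section
/- Let k, t, T be positive integers with T ≤ 2t and k > √(T(6t−T+3)). Then the optimal redundancy of function-correcting codes for the Hamming weight distribution function satisfies r_{Δ_T}(k,t) ≥ 4t − (4/3)·√(T(6t−T+3)) + 2 (an inequality of real numbers). -/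
open Finset in
lemma plotkin_coord (b : ℕ → ZMod 2) (M : ℕ) : ∃ A : ℤ,
    ∑ i ∈ range M, ∑ j ∈ range M, (if b i ≠ b j then (1 : ℤ) else 0) = 2 * M * A - 2 * A ^ 2 := by
  have key : ∀ y z : ZMod 2, (if y ≠ z then (1 : ℤ) else 0)
      = (if y = 0 then 0 else 1) + (if z = 0 then 0 else 1)
        - 2 * ((if y = 0 then 0 else 1) * (if z = 0 then 0 else 1)) := by decide
  refine ⟨∑ i ∈ range M, (if b i = 0 then (0 : ℤ) else 1), ?_⟩
  simp_rw [key, sum_sub_distrib, sum_add_distrib, ← mul_sum, ← sum_mul]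
  simp only [sum_const, card_range, nsmul_eq_mul, ← mul_sum]
  ring

open Finset in
lemma plotkin (r M : ℕ) (p : ℕ → Fin r → ZMod 2) :
    2 * ∑ i ∈ range M, ∑ j ∈ range M, (hammingDist (p i) (p j) : ℤ)
      ≤ r * ((M : ℤ) ^ 2 - (M % 2 : ℕ)) := by
  have h1 : ∑ i ∈ range M, ∑ j ∈ range M, (hammingDist (p i) (p j) : ℤ)
      = ∑ c : Fin r, ∑ i ∈ range M, ∑ j ∈ range M,
          (if p i c ≠ p j c then (1 : ℤ) else 0) := by
    symm
    rw [sum_comm]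
    refine sum_congr rfl fun i _ => ?_
    rw [sum_comm]
    refine sum_congr rfl fun j _ => ?_
    unfold hammingDist
    rw [card_filter]
    push_cast
    rfl
  rw [h1, mul_sum]
  have h2 : ∀ c ∈ (univ : Finset (Fin r)), 2 * ∑ i ∈ range M, ∑ j ∈ range M,
          (if p i c ≠ p j c then (1 : ℤ) else 0) ≤ (M : ℤ) ^ 2 - (M % 2 : ℕ) := by
    intro c _
    obtain ⟨A, hA⟩ := plotkin_coord (fun i => p i c) M
    rw [hA]
    have h3 : ((M % 2 : ℕ) : ℤ) ≤ (M - 2 * A) ^ 2 := by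
      rcases Nat.mod_two_eq_zero_or_one M with h | h
      · rw [h]; positivity
      · rw [h]
        have : (M : ℤ) - 2 * A ≠ 0 := by omega
        have := sq_pos_of_ne_zero this
        push_cast; linarith
    nlinarith
  refine (sum_le_sum h2).trans (le_of_eq ?_)
  rw [sum_const, card_univ, Fintype.card_fin, nsmul_eq_mul]

def chainVec (k i : ℕ) : Fin k → ZMod 2 := fun c => if c.val < i then 1 else 0

lemma chainVec_norm (k i : ℕ) (h : i ≤ k) : hammingNorm (chainVec k i) = i := by
  unfold hammingNorm chainVec
  have e : (Finset.univ.filter fun c : Fin k => (if c.val < i then (1 : ZMod 2) else 0) ≠ 0).map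
      Fin.valEmbedding = Finset.range i := by
    ext x
    simp only [Finset.mem_map, Finset.mem_filter, Finset.mem_univ, true_and,
      Fin.valEmbedding_apply, Finset.mem_range]
    constructor
    · rintro ⟨c, hc, rfl⟩
      by_contra hcon
      simp [hcon] at hc
    · intro hx
      exact ⟨⟨x, by omega⟩, by simp [hx], rfl⟩
  rw [← Finset.card_map Fin.valEmbedding, e, Finset.card_range]

lemma chainVec_dist (k i j : ℕ) (h : i ≤ j) :
    hammingDist (chainVec k i) (chainVec k j) ≤ j - i := by
  unfold hammingDist chainVec
  rw [← Nat.card_Ico, ← Finset.card_map Fin.valEmbedding]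
  apply Finset.card_le_card
  intro x hx
  simp only [Finset.mem_map, Finset.mem_filter, Finset.mem_univ, true_and,
    Fin.valEmbedding_apply] at hx
  obtain ⟨c, hc, rfl⟩ := hx
  simp only [Finset.mem_Ico]
  by_contra hcon
  apply hc
  by_cases h1 : c.val < i
  · simp [h1, lt_of_lt_of_le h1 h]
  · have : ¬ c.val < j := by omega
    simp [h1, this]

def hh (D b : ℤ) : ℤ := 3 * D * b * (b - 1) - (b ^ 3 - b)

def ww (D : ℤ) (T i j : ℕ) : ℤ := if i / T ≠ j / T then D - |(i : ℤ) - j| else 0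

open Finset in
lemma row_sum (D : ℤ) (T M : ℕ) (hT : 0 < T) :
    2 * ∑ i ∈ range M, ww D T i M
      = 2 * (T * (M / T) : ℕ) * (D - M) + (T * (M / T) : ℕ) * ((T * (M / T) : ℕ) - 1) := by
  set a := T * (M / T) with ha
  have haM : a ≤ M := Nat.mul_div_le M T
  have h1 : ∑ i ∈ range M, ww D T i M = ∑ i ∈ range a, (D - M + i) := by
    rw [← sum_range_add_sum_Ico _ haM]
    rw [sum_eq_zero (s := Ico a M), add_zero]
    · refine sum_congr rfl fun i hi => ?_
      have hi' := mem_range.1 hi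
      have : i / T < M / T := by
        rw [Nat.div_lt_iff_lt_mul hT]; rw [mul_comm]; exact hi'
      unfold ww
      rw [if_pos this.ne, abs_of_nonpos (by omega)]
      ring
    · intro i hi
      have hi' := mem_Ico.1 hi
      have h2 : M / T ≤ i / T := by
        rw [Nat.le_div_iff_mul_le hT, mul_comm]; exact hi'.1
      have h3 : i / T ≤ M / T := Nat.div_le_div_right hi'.2.le
      unfold ww
      rw [if_neg (by simpa using le_antisymm h3 h2)]
  rw [h1]
  clear h1 haM ha
  clear_value a
  induction a with
  | zero => simp
  | succ n ih => rw [sum_range_succ, mul_add, ih]; push_cast; ring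

open Finset in
lemma ww_sum (D : ℤ) (T M : ℕ) (hT : 0 < T) :
    3 * ∑ i ∈ range M, ∑ j ∈ range M, ww D T i j
      = hh D M - (M / T : ℕ) * hh D T - hh D (M % T : ℕ) := by
  induction M with
  | zero => simp [hh]
  | succ M ih =>
    have hsym : ∀ i j, ww D T i j = ww D T j i := by
      intro i j
      unfold ww
      rw [abs_sub_comm]
      simp only [ne_comm]
    have h0 : ww D T M M = 0 := by simp [ww]
    have e : ∑ i ∈ range (M+1), ∑ j ∈ range (M+1), ww D T i j
        = ∑ i ∈ range M, ∑ j ∈ range M, ww D T i j + 2 * ∑ i ∈ range M, ww D T i M := by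
      rw [sum_range_succ, sum_congr rfl (fun i _ => sum_range_succ _ _), sum_add_distrib,
        sum_range_succ, h0, sum_congr rfl (fun j _ => hsym M j)]
      ring
    rw [e, mul_add, ih, row_sum D T M hT]
    have hM : M = T * (M / T) + M % T := (Nat.div_add_mod M T).symm
    have hlt := Nat.mod_lt M hT
    set q := M / T
    set s := M % T
    by_cases hs : s + 1 < T
    · have h1 : (M + 1) / T = q := by
        rw [hM, add_assoc, Nat.mul_add_div hT, Nat.div_eq_of_lt hs]; rfl
      have h2 : (M + 1) % T = s + 1 := by
        rw [hM, add_assoc, Nat.mul_add_mod, Nat.mod_eq_of_lt hs]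
      rw [h1, h2]
      have hM' : (M : ℤ) = T * q + s := by exact_mod_cast hM
      unfold hh
      push_cast
      rw [hM']
      ring
    · have hs' : s + 1 = T := by omega
      have h1 : (M + 1) / T = q + 1 := by
        rw [hM, add_assoc, Nat.mul_add_div hT, hs', Nat.div_self hT]
      have h2 : (M + 1) % T = 0 := by
        rw [hM, add_assoc, Nat.mul_add_mod, hs', Nat.mod_self]
      rw [h1, h2]
      have hM' : (M : ℤ) = T * q + s := by exact_mod_cast hM
      have hs'' : (T : ℤ) = s + 1 := by exact_mod_cast hs'.symm
      unfold hh
      push_cast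
      rw [hM', hs'']
      ring

open Finset in
lemma main_ineq (k t T r M : ℕ) (hT : 0 < T) (hM : M ≤ k + 1)
    (p : (Fin k → ZMod 2) → (Fin r → ZMod 2))
    (hp : ∀ u v, hammingNorm u / T ≠ hammingNorm v / T →
      2 * t + 1 ≤ hammingDist u v + hammingDist (p u) (p v)) :
    2 * (hh (2 * t + 1) M - (M / T : ℕ) * hh (2 * t + 1) T - hh (2 * t + 1) (M % T : ℕ))
      ≤ 3 * (r * ((M : ℤ) ^ 2 - (M % 2 : ℕ))) := by
  have h1 := plotkin r M (fun i => p (chainVec k i))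
  rw [← ww_sum _ T M hT]
  have h2 : ∑ i ∈ range M, ∑ j ∈ range M, ww (2 * t + 1) T i j
      ≤ ∑ i ∈ range M, ∑ j ∈ range M,
        (hammingDist (p (chainVec k i)) (p (chainVec k j)) : ℤ) := by
    refine sum_le_sum fun i hi => sum_le_sum fun j hj => ?_
    have hi' := mem_range.1 hi
    have hj' := mem_range.1 hj
    unfold ww
    split_ifs with hne
    · have := hp (chainVec k i) (chainVec k j) (by
        rw [chainVec_norm k i (by omega), chainVec_norm k j (by omega)]; exact hne)
      rcases le_total i j with h | h
      · have hd := chainVec_dist k i j h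
        rw [abs_of_nonpos (by omega)]
        omega
      · have hd := chainVec_dist k j i h
        rw [hammingDist_comm] at hd
        rw [abs_of_nonneg (by omega)]
        omega
    · positivity
  linarith

lemma exists_code {α : Type*} (k t : ℕ) (f : (Fin k → ZMod 2) → α) :
    ∃ r : ℕ, ∃ p : (Fin k → ZMod 2) → (Fin r → ZMod 2),
    ∀ u v, f u ≠ f v → 2 * t + 1 ≤ hammingDist u v + hammingDist (p u) (p v) := by
  refine ⟨k * (2 * t + 1), fun u i => u (finProdFinEquiv.symm i).1, fun u v huv => ?_⟩
  have hne : u ≠ v := fun h => huv (by rw [h])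
  obtain ⟨c, hc⟩ := Function.ne_iff.1 hne
  refine le_trans ?_ (Nat.le_add_left _ _)
  unfold hammingDist
  have : (Finset.univ.image fun j : Fin (2 * t + 1) => finProdFinEquiv (c, j)).card
      = 2 * t + 1 := by
    rw [Finset.card_image_of_injective]
    · simp
    · intro a b h
      simpa using h
  refine this.symm.le.trans ?_
  refine Finset.card_le_card ?_
  intro x hx
  obtain ⟨j, -, rfl⟩ := Finset.mem_image.1 hx
  rw [Finset.mem_filter]
  refine ⟨Finset.mem_univ _, ?_⟩
  dsimp only
  rw [Equiv.symm_apply_apply]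
  exact hc

lemma final_one (D S r M : ℝ) (hS : 0 ≤ S) (hD : 3 ≤ D) (hSS : S ^ 2 = 3 * D - 1)
    (hMl : S - 1 ≤ M) (hMu : M ≤ S + 1) (hM3 : 3 ≤ M) (hS2 : D = 3 → M = 3) (hD5 : D = 3 ∨ 5 ≤ D)
    (h : 2 * (M * (3 * D * M - M ^ 2 - S ^ 2)) ≤ 3 * (r * (M ^ 2 - 1))) :
    2 * D - 4 / 3 * S ≤ r := by
  have hx : (S - M) ^ 2 ≤ 2 * S - M - 1 := by
    rcases hD5 with h3 | h5
    · have := hS2 h3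
      subst h3 this
      nlinarith
    · have : 3 ≤ S := by nlinarith
      nlinarith
  have h2 : 2 * (M * (3 * D - (M + 1))) ≤ 3 * (r * (M + 1)) := by
    have : 0 < M - 1 := by linarith
    refine le_of_mul_le_mul_right ?_ this
    rw [hSS] at h
    nlinarith
  have h3 : (2 * D - 4 / 3 * S) * (M + 1) ≤ r * (M + 1) := by nlinarith
  exact le_of_mul_le_mul_right h3 (by linarith)

lemma final_two (D S r M T s : ℝ) (hS : 0 ≤ S) (hT : 2 ≤ T) (hD : T + 1 ≤ D)
    (hSS : S ^ 2 = T * (3 * D - T))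
    (hMl : S - 1 ≤ M) (hMu : M ≤ S + 1) (hM0 : 0 < M) (hs1 : 1 ≤ s) (hs2 : s ≤ T - 1)
    (h : 2 * (M * (3 * D * M - M ^ 2 - S ^ 2) + s * (T - s) * (3 * D - T - s))
      ≤ 3 * (r * M ^ 2)) :
    2 * D - 4 / 3 * S ≤ r := by
  have g1 : T - 1 ≤ s * (T - s) := by nlinarith
  have g2 : 3 * D - 2 * T + 1 ≤ 3 * D - T - s := by linarith
  have g3 : (T - 1) * (3 * D - 2 * T + 1) ≤ s * (T - s) * (3 * D - T - s) :=
    mul_le_mul g1 g2 (by linarith) (by linarith)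
  have g4 : 2 * S ≤ 3 * D := by
    have : (2 * S) ^ 2 ≤ (3 * D) ^ 2 := by nlinarith [sq_nonneg (2 * T - 3 * D)]
    exact (sq_le_sq₀ (by linarith) (by linarith)).1 this
  have g5 : S + 1 ≤ (T - 1) * (3 * D - 2 * T + 1) := by nlinarith
  have g6 : (M - S) ^ 2 ≤ 1 := by nlinarith
  have g7 : M * (M - S) ^ 2 ≤ s * (T - s) * (3 * D - T - s) := by nlinarith
  have h3 : (2 * D - 4 / 3 * S) * M ^ 2 ≤ r * M ^ 2 := by nlinarith
  exact le_of_mul_le_mul_right h3 (by positivity)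

theorem stmt_7 (k t T : ℕ) (hk : 0 < k) (ht : 0 < t) (hT : 0 < T) (hT2t : T ≤ 2 * t)
    (hkT : Real.sqrt ((T : ℝ) * (6 * (t : ℝ) - (T : ℝ) + 3)) < (k : ℝ)) :
    4 * (t : ℝ) - (4 / 3) * Real.sqrt ((T : ℝ) * (6 * (t : ℝ) - (T : ℝ) + 3)) + 2
      ≤ (optRedundancy k t (fun u => hammingNorm u / T) : ℝ) := by
  have hmem := Nat.sInf_mem (exists_code k t (fun u => hammingNorm u / T))
  change optRedundancy k t (fun u => hammingNorm u / T) ∈ _ at hmem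
  generalize optRedundancy k t (fun u => hammingNorm u / T) = r at hmem ⊢
  obtain ⟨p, hp⟩ := hmem
  have htR : (1 : ℝ) ≤ t := by exact_mod_cast ht
  have hTR : (1 : ℝ) ≤ T := by exact_mod_cast hT
  have hT2R : (T : ℝ) ≤ 2 * t := by exact_mod_cast hT2t
  have hSS : Real.sqrt ((T : ℝ) * (6 * (t : ℝ) - (T : ℝ) + 3)) ^ 2
      = T * (3 * (2 * t + 1) - T) := by
    rw [Real.sq_sqrt (mul_nonneg (by linarith) (by linarith))]; ring
  have hS0 := Real.sqrt_nonneg ((T : ℝ) * (6 * (t : ℝ) - (T : ℝ) + 3))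
  generalize Real.sqrt ((T : ℝ) * (6 * (t : ℝ) - (T : ℝ) + 3)) = S at *
  have hn1 : (⌊S⌋₊ : ℝ) ≤ S := Nat.floor_le hS0
  have hn2 : S < ⌊S⌋₊ + 1 := Nat.lt_floor_add_one S
  have hnk : ⌊S⌋₊ ≤ k := by
    have : (⌊S⌋₊ : ℝ) ≤ k := by linarith
    exact_mod_cast this
  suffices 2 * (2 * (t : ℝ) + 1) - 4 / 3 * S ≤ r by linarith
  rcases Nat.lt_or_ge 1 T with hT1 | hT1
  · obtain ⟨M, hMd, hMk, hMl, hMu⟩ : ∃ M : ℕ, ¬ T ∣ M ∧ M ≤ k + 1 ∧ S - 1 ≤ M ∧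
        (M : ℝ) ≤ S + 1 := by
      by_cases hd : T ∣ ⌊S⌋₊
      · refine ⟨⌊S⌋₊ + 1, fun h => ?_, by omega, by push_cast; linarith, by push_cast; linarith⟩
        have := (Nat.dvd_add_right hd).1 h
        have := Nat.le_of_dvd one_pos this
        omega
      · exact ⟨⌊S⌋₊, hd, by omega, by linarith, by linarith⟩
    have h := main_ineq k t T r M hT hMk p hp
    have hs1 : 1 ≤ M % T := Nat.one_le_iff_ne_zero.2 fun h => hMd (Nat.dvd_of_mod_eq_zero h)
    have hs2 : M % T + 1 ≤ T := Nat.mod_lt M hT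
    have hM0 : 0 < M := Nat.pos_of_ne_zero fun h => hMd (by simp [h])
    have hdm : (M : ℝ) = T * (M / T : ℕ) + (M % T : ℕ) := by
      exact_mod_cast (Nat.div_add_mod M T).symm
    generalize M % T = s at *
    generalize M / T = q at *
    have h' : (2 * (hh (2 * t + 1) M - q * hh (2 * t + 1) T - hh (2 * t + 1) s) : ℤ)
      ≤ 3 * (r * (M : ℤ) ^ 2) := by
      refine h.trans ?_
      have : (r : ℤ) * ((M : ℤ) ^ 2 - (M % 2 : ℕ)) ≤ r * (M : ℤ) ^ 2 :=
        mul_le_mul_of_nonneg_left (by omega) (by positivity)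
      linarith
    unfold hh at h'
    have h'' : (2 * ((3 * (2 * t + 1) * M * (M - 1) - (M ^ 3 - M))
      - q * (3 * (2 * t + 1) * T * (T - 1) - (T ^ 3 - T))
      - (3 * (2 * t + 1) * s * (s - 1) - (s ^ 3 - s))) : ℝ) ≤ 3 * (r * (M : ℝ) ^ 2) := by
      exact_mod_cast h'
    have hs1R : (1 : ℝ) ≤ s := by exact_mod_cast hs1
    have hs2R : (s : ℝ) + 1 ≤ T := by exact_mod_cast hs2
    refine final_two (2 * t + 1) S r M T s hS0 (by exact_mod_cast hT1) (by linarith) hSS hMl hMu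
      (by exact_mod_cast hM0) hs1R (by linarith) (le_trans (le_of_eq ?_) h'')
    rw [hSS]
    have hq : (T : ℝ) * q = M - s := by linarith
    linear_combination 2 * (3 * (2 * (t : ℝ) + 1) * (T - 1) - (T ^ 2 - 1)) * hq
  · have hT1 : T = 1 := by omega
    subst hT1
    have hSS' : S ^ 2 = 3 * (2 * t + 1) - 1 := by rw [hSS]; push_cast; ring
    have hS2 : 2 < S := by nlinarith
    have hn2' : 2 ≤ ⌊S⌋₊ := Nat.le_floor (by exact_mod_cast hS2.le)
    obtain ⟨M, hMd, hMk, hMl, hMu, hM3, hM4⟩ : ∃ M : ℕ, M % 2 = 1 ∧ M ≤ k + 1 ∧ S - 1 ≤ M ∧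
        (M : ℝ) ≤ S + 1 ∧ 3 ≤ M ∧ M ≤ ⌊S⌋₊ + 1 := by
      rcases Nat.mod_two_eq_zero_or_one ⌊S⌋₊ with hd | hd
      · exact ⟨⌊S⌋₊ + 1, by omega, by omega, by push_cast; linarith, by push_cast; linarith,
          by omega, by omega⟩
      · exact ⟨⌊S⌋₊, hd, by omega, by linarith, by linarith, by omega, by omega⟩
    have h := main_ineq k t 1 r M hT hMk p hp
    rw [hMd, Nat.div_one, Nat.mod_one] at h
    unfold hh at h
    have h'' : (2 * ((3 * (2 * t + 1) * M * (M - 1) - (M ^ 3 - M))) : ℝ)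
        ≤ 3 * (r * ((M : ℝ) ^ 2 - 1)) := by
      have h3 : (2 * ((3 * (2 * t + 1) * M * (M - 1) - (M ^ 3 - M))) : ℤ)
        ≤ 3 * (r * ((M : ℤ) ^ 2 - 1)) := by
        refine le_trans (le_of_eq ?_) h
        push_cast; ring
      exact_mod_cast h3
    refine final_one (2 * t + 1) S r M hS0 (by linarith) hSS' hMl hMu (by exact_mod_cast hM3)
      ?_ ?_ (le_trans (le_of_eq ?_) h'')
    · intro hD
      have : S < 3 := by nlinarith
      have : ⌊S⌋₊ < 3 := (Nat.floor_lt hS0).2 (by exact_mod_cast this)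
      have : M = 3 := by omega
      exact_mod_cast this
    · rcases Nat.lt_or_ge 1 t with h1 | h1
      · right
        have : (2 : ℝ) ≤ t := by exact_mod_cast h1
        linarith
      · left
        have : t = 1 := by omega
        rw [this]; norm_num
    · rw [hSS']; ring
end

section
/- Let t, M, m, n, k be positive integers with n ≥ m and M ≥ 2t+1. Let c_0, …, c_{M−1} be binary vectors of length n with pairwise Hamming distance at least 2t+1, and write each c_i = (a_i, b_i) where a_i is the vector of the first m coordinates and b_i the vector of the remaining n−m coordinates. Assume d(a_i, a_{(i+1) mod M}) = 1 for every 0 ≤ i ≤ M−1. Define p_i = b_{i mod M} for 0 ≤ i ≤ k. Then |i − j| + d(p_i, p_j) ≥ 2t+1 for all 0 ≤ i ≠ j ≤ k. -/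
theorem stmt_8 (t M m n k : ℕ) (ht : 0 < t) (hM : 0 < M) (hm : 0 < m) (hn : 0 < n)
    (hk : 0 < k) (hmn : m ≤ n) (hMt : 2 * t + 1 ≤ M)
    (c : Fin M → (Fin n → ZMod 2))
    (hc : ∀ i j : Fin M, i ≠ j → 2 * t + 1 ≤ hammingDist (c i) (c j))
    (a : Fin M → (Fin m → ZMod 2))
    (b : Fin M → (Fin (n - m) → ZMod 2))
    (hable : ∀ (i : Fin M) (x : Fin m), a i x = c i (Fin.castLE hmn x))
    (habri : ∀ (i : Fin M) (x : Fin (n - m)),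
      b i x = c i ⟨m + (x : ℕ), by have := x.isLt; omega⟩)
    (ha : ∀ i : Fin M,
      hammingDist (a i) (a ⟨((i : ℕ) + 1) % M, Nat.mod_lt _ hM⟩) = 1)
    (p : ℕ → (Fin (n - m) → ZMod 2))
    (hp : ∀ i : ℕ, p i = b ⟨i % M, Nat.mod_lt _ hM⟩) :
    ∀ i j : ℕ, i ≤ k → j ≤ k → i ≠ j →
      2 * t + 1 ≤ Nat.dist i j + hammingDist (p i) (p j) := by
  have hsplit : ∀ i j : Fin M,
      hammingDist (c i) (c j) ≤ hammingDist (a i) (a j) + hammingDist (b i) (b j) := by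
    intro i j
    unfold hammingDist
    classical
    refine le_trans (Finset.card_le_card (t :=
      (Finset.univ.filter (fun x => a i x ≠ a j x)).image (Fin.castLE hmn) ∪
      (Finset.univ.filter (fun x => b i x ≠ b j x)).image
        (fun x : Fin (n - m) => (⟨m + (x : ℕ), by have := x.isLt; omega⟩ : Fin n))) ?_) ?_
    · intro x hx
      simp only [Finset.mem_filter, Finset.mem_univ, true_and] at hx
      simp only [Finset.mem_union, Finset.mem_image, Finset.mem_filter, Finset.mem_univ, true_and]
      by_cases h : (x : ℕ) < m
      · left
        refine ⟨⟨x, h⟩, ?_, by ext; simp⟩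
        rw [hable, hable]
        exact hx
      · right
        have hxx : (⟨m + ((x : ℕ) - m), by have := x.isLt; omega⟩ : Fin n) = x := by
          ext; simp only; omega
        refine ⟨⟨(x : ℕ) - m, by have := x.isLt; omega⟩, ?_, hxx⟩
        rw [habri, habri]
        simp only [hxx]
        exact hx
    · exact (Finset.card_union_le _ _).trans (Nat.add_le_add Finset.card_image_le Finset.card_image_le)
  have hstep : ∀ i l : ℕ, hammingDist (a ⟨i % M, Nat.mod_lt _ hM⟩)
      (a ⟨(i + l) % M, Nat.mod_lt _ hM⟩) ≤ l := by
    intro i l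
    induction l with
    | zero => simp
    | succ l ih =>
      have h1 := ha ⟨(i + l) % M, Nat.mod_lt _ hM⟩
      simp only [Nat.mod_add_mod] at h1
      have h2 := hammingDist_triangle (a ⟨i % M, Nat.mod_lt _ hM⟩)
        (a ⟨(i + l) % M, Nat.mod_lt _ hM⟩) (a ⟨(i + l + 1) % M, Nat.mod_lt _ hM⟩)
      simp only [← add_assoc]
      omega
  have key : ∀ i l : ℕ, 0 < l → 2 * t + 1 ≤ l + hammingDist (p i) (p (i + l)) := by
    intro i l hl
    by_cases h : 2 * t + 1 ≤ l
    · omega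
    have hne : (⟨i % M, Nat.mod_lt _ hM⟩ : Fin M) ≠ ⟨(i + l) % M, Nat.mod_lt _ hM⟩ := by
      intro he
      have he' : i % M = (i + l) % M := congrArg Fin.val he
      have hd : M ∣ (i + l) - i := (Nat.modEq_iff_dvd' (by omega)).mp he'
      have := Nat.le_of_dvd (by omega) hd
      omega
    have h1 := hc _ _ hne
    have h2 := hsplit ⟨i % M, Nat.mod_lt _ hM⟩ ⟨(i + l) % M, Nat.mod_lt _ hM⟩
    have h3 := hstep i l
    rw [hp, hp]
    omega
  intro i j _ _ hij
  rcases Nat.lt_or_gt_of_ne hij with h | h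
  · have := key i (j - i) (by omega)
    rw [Nat.add_sub_cancel' h.le] at this
    rwa [Nat.dist_eq_sub_of_le h.le]
  · have := key j (i - j) (by omega)
    rw [Nat.add_sub_cancel' h.le] at this
    rwa [Nat.dist_eq_sub_of_le_right h.le, hammingDist_comm]
end

section
/- Let t be a positive integer and m = ⌈log₂(2t+1)⌉. Suppose there exists a binary linear code C ⊆ 𝔽₂^n of dimension m whose minimum Hamming distance is at least 2t+1. Then for every positive integer k, the optimal redundancy of function-correcting codes for the Hamming weight function satisfies r_wt(k,t) ≤ n − m. -/
/-- Cyclic binary reflected Gray code, as a periodic sequence. -/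
def grayC (m : ℕ) (i : ℕ) : Fin m → ZMod 2 := fun b =>
  if (b : ℕ) + 1 = m then ((i / 2 ^ (b : ℕ) : ℕ) : ZMod 2)
  else ((i / 2 ^ (b : ℕ) : ℕ) : ZMod 2) + ((i / 2 ^ ((b : ℕ) + 1) : ℕ) : ZMod 2)

lemma grayC_ne {m i : ℕ} {b : Fin m} (h : grayC m i b ≠ grayC m (i + 1) b) :
    2 ^ (b : ℕ) ∣ i + 1 ∧ ((b : ℕ) + 1 = m ∨ ¬ 2 ^ ((b : ℕ) + 1) ∣ i + 1) := by
  have h2 : (1 : ZMod 2) + 1 = 0 := by decide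
  by_cases h1 : 2 ^ (b : ℕ) ∣ i + 1
  · refine ⟨h1, ?_⟩
    by_contra! h3
    apply h
    simp only [grayC, if_neg h3.1, Nat.succ_div, if_pos h1, if_pos h3.2]
    push_cast
    linear_combination -h2
  · exfalso
    have h3 : ¬ 2 ^ ((b : ℕ) + 1) ∣ i + 1 := fun h3 => h1 ((pow_dvd_pow 2 (by omega)).trans h3)
    apply h
    simp only [grayC, Nat.succ_div, if_neg h1, if_neg h3, add_zero]

lemma grayC_succ (m i : ℕ) : hammingDist (grayC m i) (grayC m (i + 1)) ≤ 1 := by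
  unfold hammingDist
  rw [Finset.card_le_one]
  have key : ∀ a b : Fin m, grayC m i a ≠ grayC m (i + 1) a → grayC m i b ≠ grayC m (i + 1) b →
      ¬ (a : ℕ) < b := by
    intro a b ha hb hab
    have h1 := grayC_ne ha
    have h2 := grayC_ne hb
    rcases h1.2 with h | h
    · omega
    · exact h ((pow_dvd_pow 2 (by omega)).trans h2.1)
  intro a ha b hb
  simp only [Finset.mem_filter, Finset.mem_univ, true_and] at ha hb
  have h1 := key a b ha hb
  have h2 := key b a hb ha
  exact Fin.ext (by omega)

lemma grayC_add (m i d : ℕ) : hammingDist (grayC m i) (grayC m (i + d)) ≤ d := by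
  induction d with
  | zero => simp
  | succ d ih =>
    have h1 := hammingDist_triangle (grayC m i) (grayC m (i + d)) (grayC m (i + (d + 1)))
    have h2 := grayC_succ m (i + d)
    rw [← add_assoc] at *
    omega

lemma grayC_inj {m i j : ℕ} (h : grayC m i = grayC m j) : i % 2 ^ m = j % 2 ^ m := by
  have hp : ∀ c b : ℕ, b + 1 + c = m →
      ((i / 2 ^ b : ℕ) : ZMod 2) = ((j / 2 ^ b : ℕ) : ZMod 2) := by
    intro c
    induction c with
    | zero =>
      intro b hb
      have := congrFun h ⟨b, by omega⟩
      simpa [grayC, show b + 1 = m by omega] using this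
    | succ c ih =>
      intro b hb
      have h1 := congrFun h ⟨b, by omega⟩
      have h2 := ih (b + 1) (by omega)
      simp only [grayC, if_neg (show ¬ b + 1 = m by omega), h2] at h1
      exact add_right_cancel h1
  have hq : ∀ b ≤ m, i % 2 ^ b = j % 2 ^ b := by
    intro b
    induction b with
    | zero => intro _; simp [Nat.mod_one]
    | succ b ih =>
      intro hb
      rw [Nat.mod_pow_succ, Nat.mod_pow_succ, ih (by omega)]
      have := (ZMod.natCast_eq_natCast_iff' _ _ _).1 (hp (m - (b + 1)) b (by omega))
      rw [this]
  exact hq m le_rfl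

lemma exists_info {n m : ℕ} (C : Submodule (ZMod 2) (Fin n → ZMod 2))
    (hdim : Module.finrank (ZMod 2) C = m) :
    ∃ e : Fin m → Fin n, Function.Injective e ∧
      ∀ w : Fin m → ZMod 2, ∃ c ∈ C, ∀ i, c (e i) = w i := by
  let φ : Fin n → Module.Dual (ZMod 2) C := fun i => (LinearMap.proj i).comp C.subtype
  obtain ⟨κ, a, ha, hspan, hli⟩ := exists_linearIndependent' (ZMod 2) φ
  have : Finite κ := Finite.of_injective a ha
  have : Fintype κ := Fintype.ofFinite κ
  let T : C →ₗ[ZMod 2] (κ → ZMod 2) := LinearMap.pi (fun i => φ (a i))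
  have hT : Function.Injective T := by
    rw [injective_iff_map_eq_zero]
    intro x hx
    have h1 : Submodule.span (ZMod 2) (Set.range φ) ≤
        LinearMap.ker (Module.Dual.eval (ZMod 2) C x) := by
      rw [← hspan, Submodule.span_le]
      rintro _ ⟨i, rfl⟩
      simpa [T] using congrFun hx i
    ext i
    have := h1 (Submodule.subset_span ⟨i, rfl⟩)
    simpa [φ] using this
  have h1 : Fintype.card κ ≤ m := by
    have := hli.fintype_card_le_finrank
    rwa [Subspace.dual_finrank_eq, hdim] at this
  have h2 : m ≤ Fintype.card κ := by
    have := LinearMap.finrank_le_finrank_of_injective hT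
    rwa [hdim, Module.finrank_fintype_fun_eq_card] at this
  have hs : Function.Surjective T :=
    (LinearMap.injective_iff_surjective_of_finrank_eq_finrank
      (by rw [hdim, Module.finrank_fintype_fun_eq_card]; omega)).1 hT
  let E : Fin m ≃ κ := Fintype.equivOfCardEq (by simp; omega)
  refine ⟨a ∘ E, ha.comp E.injective, fun w => ?_⟩
  obtain ⟨c, hc⟩ := hs (w ∘ E.symm)
  refine ⟨c, c.2, fun i => ?_⟩
  have := congrFun hc (E i)
  simpa [T, φ] using this

lemma exists_split {n m : ℕ} (e : Fin m → Fin n) (he : Function.Injective e) :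
    ∃ f : Fin (n - m) → Fin n, ∀ x y : Fin n → ZMod 2,
      hammingDist x y = hammingDist (x ∘ e) (y ∘ e) + hammingDist (x ∘ f) (y ∘ f) := by
  classical
  have hc : Fintype.card {x // ¬ x ∈ Set.range e} = n - m := by
    rw [Fintype.card_subtype_compl, Fintype.card_fin]
    congr 1
    have := Fintype.card_congr (Equiv.ofInjective e he)
    rw [Fintype.card_fin] at this
    exact (Fintype.card_congr (Equiv.refl _)).trans this.symm
  let F : Fin (n - m) ≃ {x // ¬ x ∈ Set.range e} := Fintype.equivOfCardEq (by simpa using hc.symm)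
  let E : Fin m ⊕ Fin (n - m) ≃ Fin n :=
    ((Equiv.ofInjective e he).sumCongr F).trans (Equiv.sumCompl (· ∈ Set.range e))
  refine ⟨fun i => F i, fun x y => ?_⟩
  simp only [hammingDist, Finset.card_filter]
  rw [← E.sum_comp, Fintype.sum_sum_type]
  rfl

theorem stmt_10 (t n : ℕ) (ht : 0 < t)
    (C : Submodule (ZMod 2) (Fin n → ZMod 2))
    (hdim : Module.finrank (ZMod 2) C = Nat.clog 2 (2 * t + 1))
    (hdist : ∀ x ∈ C, ∀ y ∈ C, x ≠ y → 2 * t + 1 ≤ hammingDist x y) :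
    ∀ k : ℕ, 0 < k →
      optRedundancy k t (fun u => hammingNorm u) ≤ n - Nat.clog 2 (2 * t + 1) := by
  intro k _
  have hm : 2 * t + 1 ≤ 2 ^ Nat.clog 2 (2 * t + 1) := Nat.le_pow_clog (by norm_num) _
  generalize Nat.clog 2 (2 * t + 1) = m at *
  obtain ⟨e, he, hsurj⟩ := exists_info C hdim
  obtain ⟨f, hf⟩ := exists_split e he
  choose c hcC hce using hsurj
  apply Nat.sInf_le
  refine ⟨fun u => c (grayC m (hammingNorm u)) ∘ f, ?_⟩
  have key : ∀ u v : Fin k → ZMod 2, hammingNorm u < hammingNorm v →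
      2 * t + 1 ≤ hammingDist u v + hammingDist (c (grayC m (hammingNorm u)) ∘ f)
        (c (grayC m (hammingNorm v)) ∘ f) := by
    intro u v huv
    have htri : hammingNorm v ≤ hammingDist u v + hammingNorm u := by
      have := hammingDist_triangle v u 0
      rwa [hammingDist_zero_right, hammingDist_zero_right, hammingDist_comm v u] at this
    obtain ⟨d, hd⟩ := Nat.exists_eq_add_of_lt huv
    by_cases hbig : 2 * t + 1 ≤ d + 1
    · omega
    have hg : grayC m (hammingNorm u) ≠ grayC m (hammingNorm v) := by
      intro h
      have h1 := grayC_inj h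
      have h2 := (Nat.modEq_iff_dvd' huv.le).1 h1
      have := Nat.le_of_dvd (by omega) h2
      omega
    have hle := grayC_add m (hammingNorm u) (d + 1)
    rw [← add_assoc, ← hd] at hle
    have hcomp : ∀ w, c w ∘ e = w := fun w => funext (hce w)
    have hne : c (grayC m (hammingNorm u)) ≠ c (grayC m (hammingNorm v)) := by
      intro h
      apply hg
      rw [← hcomp (grayC m (hammingNorm u)), h, hcomp]
    have h3 := hdist _ (hcC _) _ (hcC _) hne
    rw [hf, hcomp, hcomp] at h3
    omega
  intro u v huv
  rcases lt_or_gt_of_ne huv with h | h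
  · exact key u v h
  · have := key v u h
    rwa [hammingDist_comm v u, hammingDist_comm (c (grayC m (hammingNorm v)) ∘ f)] at this
end

section
/- Let t be a positive integer such that t+1 is a power of two. Then for every positive integer k, the optimal redundancy of function-correcting codes for the Hamming weight function satisfies r_wt(k,t) ≤ 4t − ⌈log₂ t⌉. -/
theorem hd_sum {ι κ : Type} [Fintype ι] [Fintype κ] (a b : ι → ZMod 2) (c d : κ → ZMod 2) :
    hammingDist (Sum.elim a c) (Sum.elim b d) = hammingDist a b + hammingDist c d := by
  simp only [hammingDist, Finset.card_filter, Fintype.sum_sum_type, Sum.elim_inl, Sum.elim_inr]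
  rfl

theorem hd_compl {ι : Type} [Fintype ι] (a b : ι → ZMod 2) (x y : ZMod 2) (h : x ≠ y) :
    hammingDist a b + hammingDist (fun i => a i + x) (fun i => b i + y) = Fintype.card ι := by
  simp only [hammingDist, Finset.card_filter]
  rw [← Finset.sum_add_distrib, Fintype.card_eq_sum_ones]
  refine Finset.sum_congr rfl fun i _ => ?_
  have key : ∀ p q x y : ZMod 2, x ≠ y →
      (if p ≠ q then 1 else 0) + (if p + x ≠ q + y then 1 else 0) = 1 := by decide
  exact key _ _ _ _ h

/-- The simplex code. -/
theorem simplex_code (M : ℕ) : ∃ (ι : Type) (_ : Fintype ι) (c : ℕ → ι → ZMod 2),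
    Fintype.card ι + 1 = 2 ^ M ∧
      ∀ i j, i % 2 ^ M ≠ j % 2 ^ M → 2 ^ M ≤ 2 * hammingDist (c i) (c j) := by
  induction M with
  | zero => exact ⟨Empty, inferInstance, fun _ _ => 0, by simp, fun i j h => by simp [Nat.mod_one] at h⟩
  | succ M ih =>
    obtain ⟨ι, _, c, hc, hd⟩ := ih
    refine ⟨ι ⊕ (ι ⊕ Unit), inferInstance, fun i => Sum.elim (c (i / 2))
      (Sum.elim (fun x => c (i / 2) x + (i : ZMod 2)) (fun _ => (i : ZMod 2))), ?_, ?_⟩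
    · simp only [Fintype.card_sum, Fintype.card_unit, pow_succ]; omega
    · intro i j hij
      rw [hd_sum, hd_sum]
      by_cases hb : (i : ZMod 2) = (j : ZMod 2)
      · have h2 : i / 2 % 2 ^ M ≠ j / 2 % 2 ^ M := by
          intro h
          apply hij
          have hb' := (ZMod.natCast_eq_natCast_iff' i j 2).1 hb
          rw [pow_succ', Nat.mod_mul, Nat.mod_mul, h, hb']
        have h3 := hd _ _ h2
        have h4 : hammingDist (fun x => c (i / 2) x + (i : ZMod 2))
            (fun x => c (j / 2) x + (j : ZMod 2)) = hammingDist (c (i / 2)) (c (j / 2)) := by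
          simp only [hammingDist, hb, ne_eq, add_left_inj]
        rw [h4, pow_succ]; omega
      · have h1 := hd_compl (c (i / 2)) (c (j / 2)) _ _ hb
        have h2 : hammingDist (fun _ : Unit => (i : ZMod 2)) (fun _ : Unit => (j : ZMod 2)) = 1 := by
          simp [hammingDist, hb]
        rw [pow_succ]; omega

/-- Recursive construction of the parity sequence. -/
theorem weight_seq (m : ℕ) : ∃ (ι : Type) (_ : Fintype ι) (c : ℕ → ι → ZMod 2),
    Fintype.card ι + m + 4 = 4 * 2 ^ m ∧
      ∀ i j, i < j → 2 * 2 ^ m ≤ (j - i) + hammingDist (c i) (c j) + 1 := by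
  induction m with
  | zero => exact ⟨Empty, inferInstance, fun _ _ => 0, by simp, fun i j h => by simp; omega⟩
  | succ m ih =>
    obtain ⟨ι, _, c, hc, hd⟩ := ih
    obtain ⟨κ, _, e, he, hf⟩ := simplex_code (m + 2)
    refine ⟨ι ⊕ κ, inferInstance, fun i => Sum.elim (c i) (e i), ?_, ?_⟩
    · simp only [Fintype.card_sum, pow_succ] at *; omega
    · intro i j hij
      rw [hd_sum]
      have h1 := hd i j hij
      by_cases hs : 2 ^ (m + 2) ≤ j - i
      · simp only [pow_succ] at *; omega
      · have h2 : i % 2 ^ (m + 2) ≠ j % 2 ^ (m + 2) := by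
          intro h
          have h3 := (Nat.modEq_iff_dvd' hij.le).1 h
          exact hs (Nat.le_of_dvd (by omega) h3)
        have h4 := hf i j h2
        simp only [pow_succ] at *; omega

theorem stmt_11 (t : ℕ) (ht : 0 < t) (hpow : ∃ m : ℕ, t + 1 = 2 ^ m) :
    ∀ k : ℕ, 0 < k →
      optRedundancy k t (fun u => hammingNorm u) ≤ 4 * t - Nat.clog 2 t := by
  intro k _
  obtain ⟨m, hm⟩ := hpow
  obtain ⟨ι, _, c, hc, hd⟩ := weight_seq m
  have hcl : Nat.clog 2 t ≤ m := Nat.clog_le_of_le_pow (by omega)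
  have hcard : Fintype.card ι ≤ 4 * t - Nat.clog 2 t := by omega
  refine le_trans (Nat.sInf_le ?_) hcard
  let eq := (Fintype.equivFin ι).symm
  refine ⟨fun u x => c (hammingNorm u) (eq x), ?_⟩
  have hre : ∀ a b : ι → ZMod 2,
      hammingDist (fun x => a (eq x)) (fun x => b (eq x)) = hammingDist a b := by
    intro a b
    simp only [hammingDist, Finset.card_filter]
    exact Equiv.sum_comp eq (fun x => if a x ≠ b x then 1 else 0)
  intro u v huv
  change hammingNorm u ≠ hammingNorm v at huv
  rw [hre]
  have h1 := hammingDist_triangle u v 0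
  have h2 := hammingDist_triangle v u 0
  rw [hammingDist_zero_right, hammingDist_zero_right] at h1 h2
  rw [hammingDist_comm v u] at h2
  rcases lt_or_gt_of_ne huv with h | h
  · have := hd _ _ h
    omega
  · have := hd _ _ h
    rw [hammingDist_comm (c (hammingNorm u))]
    omega
end

section
/- For every integer m ≥ 2 there exists a binary linear code of length 2^{m+1} − 3, dimension m, and minimum Hamming distance exactly 2^m − 1 (obtained by repeating the simplex code of length 2^m − 1 twice and deleting one coordinate). -/
/-- Half of the vectors pair nontrivially with a fixed nonzero vector. -/
theorem card_dot_ne (m : ℕ) (u : Fin m → ZMod 2) (hu : u ≠ 0) :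
    2 * (Finset.univ.filter fun v : Fin m → ZMod 2 => u ⬝ᵥ v ≠ 0).card = 2 ^ m := by
  classical
  obtain ⟨j, hj⟩ := Function.ne_iff.mp hu
  have h01 : ∀ a : ZMod 2, a ≠ 0 → a = 1 := by decide
  have hj1 : u j = 1 := h01 _ hj
  have hw : u ⬝ᵥ (Pi.single j 1) = 1 := by simp [hj1]
  have hcard : (Finset.univ.filter fun v : Fin m → ZMod 2 => u ⬝ᵥ v ≠ 0).card =
      (Finset.univ.filter fun v : Fin m → ZMod 2 => ¬ u ⬝ᵥ v ≠ 0).card := by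
    refine Finset.card_equiv (Equiv.addRight (Pi.single j 1)) ?_
    intro v
    simp only [Finset.mem_filter, Finset.mem_univ, true_and, Equiv.coe_addRight, dotProduct_add, hw]
    generalize u ⬝ᵥ v = a
    revert a
    decide
  have h := Finset.card_filter_add_card_filter_not (s := Finset.univ)
    (fun v : Fin m → ZMod 2 => u ⬝ᵥ v ≠ 0)
  rw [← hcard] at h
  simp [ZMod.card] at h
  simp
  omega

theorem stmt_12 (m : ℕ) (hm : 2 ≤ m) :
    ∃ C : Submodule (ZMod 2) (Fin (2 ^ (m + 1) - 3) → ZMod 2),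
      Module.finrank (ZMod 2) C = m ∧
      (∀ x ∈ C, ∀ y ∈ C, x ≠ y → 2 ^ m - 1 ≤ hammingDist x y) ∧
      (∃ x ∈ C, ∃ y ∈ C, x ≠ y ∧ hammingDist x y = 2 ^ m - 1) := by
  classical
  have h4 : 2 ^ 2 ≤ 2 ^ m := Nat.pow_le_pow_right (by norm_num) hm
  let e0 : Fin m → ZMod 2 := Pi.single ⟨0, by omega⟩ 1
  have he0 : e0 ≠ 0 := by simp [e0]
  let S : Finset ((Fin m → ZMod 2) × Bool) := {(0, false), (0, true), (e0, false)}
  have hS : S.card = 3 := by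
    rw [Finset.card_eq_three]
    refine ⟨_, _, _, ?_, ?_, ?_, rfl⟩ <;> simp [he0.symm]
  have hI : Fintype.card {p // p ∈ Sᶜ} = 2 ^ (m + 1) - 3 := by
    rw [Fintype.card_coe, Finset.card_compl, hS]
    simp [ZMod.card, pow_succ]
  let e : Fin (2 ^ (m + 1) - 3) ≃ {p // p ∈ Sᶜ} := (Fintype.equivFinOfCardEq hI).symm
  let φ : (Fin m → ZMod 2) →ₗ[ZMod 2] (Fin (2 ^ (m + 1) - 3) → ZMod 2) :=
    { toFun := fun u i => u ⬝ᵥ (e i).1.1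
      map_add' := fun u v => by ext i; simp [add_dotProduct]
      map_smul' := fun c v => by ext i; simp [smul_dotProduct] }
  have hφ : ∀ u i, φ u i = u ⬝ᵥ (e i).1.1 := fun _ _ => rfl
  have hwt : ∀ u, u ≠ 0 → hammingNorm (φ u) = if u ⬝ᵥ e0 ≠ 0 then 2 ^ m - 1 else 2 ^ m := by
    intro u hu
    have h1 : hammingNorm (φ u) = (((Finset.univ.filter fun v : Fin m → ZMod 2 => u ⬝ᵥ v ≠ 0) ×ˢ
        (Finset.univ : Finset Bool)).erase (e0, false)).card := by
      unfold hammingNorm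
      refine Finset.card_bij (fun i _ => (e i).1) ?_ ?_ ?_
      · intro i hi
        have h2 := (e i).2
        simp only [S, Finset.mem_compl, Finset.mem_insert, Finset.mem_singleton, not_or] at h2
        simp only [Finset.mem_filter, Finset.mem_univ, true_and, hφ] at hi
        simp only [Finset.mem_erase, Finset.mem_product, Finset.mem_filter, Finset.mem_univ,
          true_and, and_true]
        exact ⟨h2.2.2, hi⟩
      · intro i _ j _ h
        exact e.injective (Subtype.ext h)
      · rintro ⟨v, b⟩ h
        simp only [Finset.mem_erase, Finset.mem_product, Finset.mem_filter, Finset.mem_univ,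
          true_and, and_true] at h
        have hv : v ≠ 0 := by
          rintro rfl
          exact h.2 (by simp)
        have hmem : (v, b) ∈ Sᶜ := by
          simp only [S, Finset.mem_compl, Finset.mem_insert, Finset.mem_singleton, not_or]
          exact ⟨by simp [hv], by simp [hv], h.1⟩
        refine ⟨e.symm ⟨(v, b), hmem⟩, ?_, ?_⟩
        · simp [hφ, h.2]
        · simp
    rw [h1, Finset.card_erase_eq_ite, Finset.card_product]
    have := card_dot_ne m u hu
    simp only [Finset.mem_product, Finset.mem_filter, Finset.mem_univ, true_and, and_true,
      Finset.card_univ, Fintype.card_bool]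
    rw [mul_comm, this]
  have hinj : Function.Injective φ := by
    rw [injective_iff_map_eq_zero]
    intro u hu
    by_contra hne
    have := hwt u hne
    rw [hu, hammingNorm_zero] at this
    split_ifs at this <;> omega
  refine ⟨LinearMap.range φ, ?_, ?_, ?_⟩
  · rw [LinearMap.finrank_range_of_inj hinj]
    simp
  · rintro _ ⟨u, rfl⟩ _ ⟨v, rfl⟩ hne
    have huv : -u + v ≠ 0 := fun h => hne (by rw [neg_add_eq_zero.mp h])
    rw [hammingDist_eq_hammingNorm, ← map_neg, ← map_add, hwt _ huv]
    split_ifs <;> omega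
  · refine ⟨φ e0, ⟨_, rfl⟩, 0, Submodule.zero_mem _, ?_, ?_⟩
    · intro h
      exact he0 (hinj (by rw [h, map_zero]))
    · rw [hammingDist_zero_right, hwt _ he0, if_pos]
      simp [e0]
end

section
/- Let k, t, T, s be positive integers and set E = ⌊k/T⌋ + 1. Suppose there exist binary vectors q_0, …, q_{E−1} of length s such that d(q_i, q_j) ≥ 2t+1 − T·|i−j| for all 0 ≤ i ≠ j ≤ E−1. Then the map Enc(u) = (u, q_{Δ_T(u)}, p_{wt(u) mod T}), where p_i = (0^{T−1−i} 1^i) ∈ 𝔽₂^{T−1} for 0 ≤ i ≤ T−1, is a function-correcting code for Δ_T correcting t errors; in particular r_{Δ_T}(k,t) ≤ s + T − 1. -/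
/-- The vector `p_i = (0^{T-1-i} 1^i) ∈ 𝔽₂^{T-1}`: first `T-1-i` coordinates are `0`,
last `i` coordinates are `1`. -/
def pvec (T i : ℕ) : Fin (T - 1) → ZMod 2 :=
  fun x => if T - 1 - i ≤ (x : ℕ) then 1 else 0

lemma hammingNorm_le_dist_add {n : ℕ} (x y : Fin n → ZMod 2) :
    hammingNorm x ≤ hammingDist x y + hammingNorm y := by
  have := hammingDist_triangle x y 0
  simpa using this

lemma hammingNorm_pvec (T i : ℕ) (h : i < T) : hammingNorm (pvec T i) = i := by
  have h1 : hammingNorm (pvec T i)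
      = (Finset.univ.filter (fun x : Fin (T - 1) => T - 1 - i ≤ (x : ℕ))).card := by
    unfold hammingNorm pvec
    congr 1
    ext x
    simp
  rw [h1, Finset.card_filter,
    Fin.sum_univ_eq_sum_range (fun x => if T - 1 - i ≤ x then 1 else 0) (T - 1),
    ← Finset.card_filter]
  have h2 : (Finset.range (T - 1)).filter (fun x => T - 1 - i ≤ x)
      = Finset.Ico (T - 1 - i) (T - 1) := by
    ext x
    simp only [Finset.mem_filter, Finset.mem_range, Finset.mem_Ico]
    omega
  rw [h2, Nat.card_Ico]
  omega

lemma hammingDist_append {m n : ℕ} (a b : Fin m → ZMod 2) (c d : Fin n → ZMod 2) :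
    hammingDist (Fin.append a c) (Fin.append b d) = hammingDist a b + hammingDist c d := by
  unfold hammingDist
  simp only [Finset.card_filter]
  rw [Fin.sum_univ_add]
  simp

theorem stmt_13 (k t T s : ℕ) (hk : 0 < k) (ht : 0 < t) (hT : 0 < T) (hs : 0 < s)
    (q : ℕ → (Fin s → ZMod 2))
    (hq : ∀ i j : ℕ, i < k / T + 1 → j < k / T + 1 → i ≠ j →
      2 * t + 1 - T * Nat.dist i j ≤ hammingDist (q i) (q j)) :
    (∀ u v : Fin k → ZMod 2, hammingNorm u / T ≠ hammingNorm v / T →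
      2 * t + 1 ≤ hammingDist u v
        + hammingDist (q (hammingNorm u / T)) (q (hammingNorm v / T))
        + hammingDist (pvec T (hammingNorm u % T)) (pvec T (hammingNorm v % T))) ∧
    optRedundancy k t (fun u => hammingNorm u / T) ≤ s + T - 1 := by
  have main : ∀ u v : Fin k → ZMod 2, hammingNorm u / T ≠ hammingNorm v / T →
      2 * t + 1 ≤ hammingDist u v
        + hammingDist (q (hammingNorm u / T)) (q (hammingNorm v / T))
        + hammingDist (pvec T (hammingNorm u % T)) (pvec T (hammingNorm v % T)) := by
    intro u v huv
    have hb : ∀ w : Fin k → ZMod 2, hammingNorm w / T < k / T + 1 := by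
      intro w
      have : hammingNorm w ≤ k := by simpa using hammingNorm_le_card_fintype (x := w)
      exact Nat.lt_succ_of_le (Nat.div_le_div_right this)
    have h0 := hq _ _ (hb u) (hb v) huv
    have h1 := hammingNorm_le_dist_add u v
    have h2 := hammingNorm_le_dist_add v u
    rw [hammingDist_comm v u] at h2
    have hu := Nat.mod_lt (hammingNorm u) hT
    have hv := Nat.mod_lt (hammingNorm v) hT
    have h3 := hammingNorm_le_dist_add (pvec T (hammingNorm u % T)) (pvec T (hammingNorm v % T))
    have h4 := hammingNorm_le_dist_add (pvec T (hammingNorm v % T)) (pvec T (hammingNorm u % T))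
    rw [hammingDist_comm (pvec T (hammingNorm v % T))] at h4
    rw [hammingNorm_pvec _ _ hu, hammingNorm_pvec _ _ hv] at h3 h4
    have eu := Nat.div_add_mod (hammingNorm u) T
    have ev := Nat.div_add_mod (hammingNorm v) T
    have hd : T * Nat.dist (hammingNorm u / T) (hammingNorm v / T)
        = (T * (hammingNorm u / T) - T * (hammingNorm v / T))
          + (T * (hammingNorm v / T) - T * (hammingNorm u / T)) := by
      rw [Nat.dist, Nat.mul_add, Nat.mul_sub, Nat.mul_sub]
    rw [hd] at h0
    generalize T * (hammingNorm u / T) = A at *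
    generalize T * (hammingNorm v / T) = B at *
    omega
  refine ⟨main, ?_⟩
  rw [Nat.add_sub_assoc hT]
  apply Nat.sInf_le
  refine ⟨fun u => Fin.append (q (hammingNorm u / T)) (pvec T (hammingNorm u % T)), ?_⟩
  intro u v huv
  have := main u v huv
  rw [hammingDist_append]
  omega
end

section
/- Let T ≥ 1 and m ≥ 2 be integers and let t be a positive integer with 2t+1 = T·(2^m − 1). Then for every positive integer k, the optimal redundancy of function-correcting codes for the Hamming weight distribution function satisfies r_{Δ_T}(k,t) ≤ 4t − mT + 1. -/
/-- A cyclic Gray code. -/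
theorem gray_exists (m : ℕ) : ∃ g : ℕ → (Fin (m+1) → ZMod 2),
    (∀ n, hammingDist (g n) (g (n+1)) ≤ 1) ∧ ∀ i j, g i = g j → i ≡ j [MOD 2^(m+1)] := by
  induction m with
  | zero =>
    refine ⟨fun n _ => (n : ZMod 2), fun n => ?_, fun i j hij => ?_⟩
    · exact (hammingDist_le_card_fintype).trans (by simp)
    · have := congrFun hij 0
      simpa using (ZMod.natCast_eq_natCast_iff i j 2).1 this
  | succ m ih =>
    obtain ⟨g, h1, h2⟩ := ih
    refine ⟨fun n => Fin.cons (((n+1)/2 : ℕ) : ZMod 2) (g (n/2)), fun n => ?_, fun i j hij => ?_⟩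
    · have key : ∀ (a b : ZMod 2) (x y : Fin (m+1) → ZMod 2),
          hammingDist (Fin.cons a x : Fin (m+2) → ZMod 2) (Fin.cons b y)
            = (if a ≠ b then 1 else 0) + hammingDist x y := by
        intro a b x y
        simp only [hammingDist, Finset.card_filter]
        rw [Fin.sum_univ_succ]
        simp
      rw [key]
      rcases Nat.even_or_odd' n with ⟨k, rfl | rfl⟩
      · have e1 : (2*k+1)/2 = k := by omega
        have e2 : 2*k/2 = k := by omega
        rw [e1, e2, hammingDist_self]
        split_ifs <;> simp
      · have e1 : (2*k+1+1)/2 = k+1 := by omega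
        have e2 : (2*k+1)/2 = k := by omega
        have e3 : (2*k+1+1+1)/2 = k+1 := by omega
        rw [e1, e2, e3]
        simpa using h1 k
    · obtain ⟨ha, hb⟩ := Fin.cons_injective2 hij
      have h3 := (ZMod.natCast_eq_natCast_iff _ _ 2).1 ha
      have h4 := h2 _ _ hb
      have h5 : i/2 ≡ j/2 [MOD 2] := h4.of_dvd (dvd_pow_self 2 (by omega))
      have h6 : i % 2 = j % 2 := by
        unfold Nat.ModEq at h3 h5
        omega
      have h7 : 2*(i/2) ≡ 2*(j/2) [MOD 2*2^(m+1)] := h4.mul_left' 2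
      have h8 := h7.add_right (i%2)
      rw [Nat.div_add_mod, h6, Nat.div_add_mod] at h8
      rwa [pow_succ' 2 (m+1)]

theorem gray_dist {m : ℕ} (g : ℕ → (Fin m → ZMod 2))
    (h1 : ∀ n, hammingDist (g n) (g (n+1)) ≤ 1) (i d : ℕ) :
    hammingDist (g i) (g (i+d)) ≤ d := by
  induction d with
  | zero => simp
  | succ d ih =>
    exact (hammingDist_triangle _ (g (i+d)) _).trans (Nat.add_le_add ih (h1 (i+d)))

theorem half_count {m : ℕ} (x : Fin m → ZMod 2) (hx : x ≠ 0) :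
    2 * (Finset.univ.filter (fun a : Fin m → ZMod 2 => a ⬝ᵥ x ≠ 0)).card = 2^m := by
  obtain ⟨j, hj⟩ := Function.ne_iff.1 hx
  have hj1 : x j = 1 := by
    have : ∀ z : ZMod 2, z ≠ 0 → z = 1 := by decide
    exact this _ hj
  have hb : (Finset.univ.filter (fun a : Fin m → ZMod 2 => a ⬝ᵥ x ≠ 0)).card
      = (Finset.univ.filter (fun a : Fin m → ZMod 2 => ¬ (a ⬝ᵥ x ≠ 0))).card := by
    have hz : ∀ z : ZMod 2, z ≠ 0 ↔ z + 1 = 0 := by decide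
    apply Finset.card_bijective (fun a => a + Pi.single j 1) (AddGroup.addRight_bijective _)
    intro a
    simp only [Finset.mem_filter, Finset.mem_univ, true_and, add_dotProduct,
      single_dotProduct, hj1, one_mul, not_not]
    exact hz _
  have := Finset.card_filter_add_card_filter_not (s := (Finset.univ : Finset (Fin m → ZMod 2)))
    (fun a => a ⬝ᵥ x ≠ 0)
  simp only [Finset.card_univ, Fintype.card_fun, ZMod.card, Fintype.card_fin] at this
  omega

/-- The removed coordinates. -/
def rem (T m : ℕ) : (Fin (T+1) × Fin 2) ⊕ (Fin (T+1) × Fin (m+1)) ⊕ Unit →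
    Fin (T+1) × (Fin (m+1) → ZMod 2) × Fin 2
  | .inl (s, b) => (s, 0, b)
  | .inr (.inl (s, i)) => (s, Pi.single i 1, 0)
  | .inr (.inr _) => (0, Pi.single 0 1, 1)

theorem rem_inj (T m : ℕ) : Function.Injective (rem T m) := by
  have hs : ∀ i : Fin (m+1), (Pi.single i 1 : Fin (m+1) → ZMod 2) ≠ 0 := by
    intro i; simp
  have hi : Function.Injective (fun i : Fin (m+1) => (Pi.single i 1 : Fin (m+1) → ZMod 2)) := by
    intro i j hij
    by_contra hne
    have := congrFun hij i
    simp [hne] at this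
  rintro (⟨s, b⟩ | ⟨s, i⟩ | ⟨⟩) (⟨s', b'⟩ | ⟨s', i'⟩ | ⟨⟩) hh <;>
    simp only [rem, Prod.mk.injEq] at hh
  · simp [hh.1, hh.2.2]
  · exact absurd hh.2.1.symm (hs _)
  · exact absurd hh.2.1.symm (hs _)
  · exact absurd hh.2.1 (hs _)
  · simp [hh.1, hi hh.2.1]
  · simp at hh
  · exact absurd hh.2.1 (hs _)
  · simp at hh
  · rfl

/-- The kept coordinates. -/
def kept (T m : ℕ) : Finset (Fin (T+1) × (Fin (m+1) → ZMod 2) × Fin 2) :=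
  (Finset.univ.image (rem T m))ᶜ

theorem kept_card (T m : ℕ) :
    (kept T m).card + (2 * (T+1) + (m+1) * (T+1) + 1) = 2 * (T+1) * 2^(m+1) := by
  have h1 := Finset.card_add_card_compl (Finset.univ.image (rem T m))
  rw [Finset.card_image_of_injective _ (rem_inj T m)] at h1
  simp only [Finset.card_univ, Fintype.card_sum, Fintype.card_prod, Fintype.card_fin,
    Fintype.card_fun, ZMod.card, Fintype.card_unit] at h1
  unfold kept
  linarith

/-- The encoding. -/
def enc (T m : ℕ) (x : Fin (m+1) → ZMod 2) (c : kept T m) : ZMod 2 := c.1.2.1 ⬝ᵥ x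

theorem enc_dist (T m : ℕ) (x y : Fin (m+1) → ZMod 2) (hxy : x ≠ y) :
    (T+1) * 2^(m+1) ≤ hammingDist (enc T m x) (enc T m y) + (T+1) * hammingDist x y + 1 := by
  classical
  let P : Fin (T+1) × (Fin (m+1) → ZMod 2) × Fin 2 → Prop := fun c => c.2.1 ⬝ᵥ x ≠ c.2.1 ⬝ᵥ y
  have e1 : hammingDist (enc T m x) (enc T m y) = ∑ c ∈ kept T m, if P c then 1 else 0 := by
    simp only [hammingDist, Finset.card_filter]
    exact Finset.sum_coe_sort (kept T m) (fun c => if P c then 1 else 0)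
  have e2 : ∑ c ∈ Finset.univ.image (rem T m), (if P c then 1 else 0)
      ≤ (T+1) * hammingDist x y + 1 := by
    rw [Finset.sum_image (fun _ _ _ _ h => rem_inj T m h)]
    rw [Fintype.sum_sum_type, Fintype.sum_sum_type, Fintype.sum_prod_type, Fintype.sum_prod_type]
    have : (∑ i : Fin (m+1), if x i ≠ y i then 1 else 0) = hammingDist x y := by
      simp only [hammingDist, Finset.card_filter]
    simp only [rem, P, zero_dotProduct, single_dotProduct, one_mul, this]
    simp
    split_ifs <;> simp
  have e3 : ∑ c, (if P c then 1 else 0) = (T+1) * 2^(m+1) := by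
    have hc := half_count (x - y) (sub_ne_zero.2 hxy)
    simp only [dotProduct_sub, sub_ne_zero] at hc
    rw [Finset.card_filter] at hc
    obtain ⟨F, hF⟩ : ∃ F : (Fin (m+1) → ZMod 2) → ℕ,
        F = fun a => if a ⬝ᵥ x ≠ a ⬝ᵥ y then 1 else 0 := ⟨_, rfl⟩
    have e5 : ∀ c, (if P c then 1 else 0) = F c.2.1 := by
      intro c
      rw [hF]
    have hc' : 2 * ∑ a, F a = 2^(m+1) := by
      rw [hF, ← hc]
    rw [Finset.sum_congr rfl (fun c _ => e5 c), Fintype.sum_prod_type]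
    simp only [Fintype.sum_prod_type, Finset.sum_const, Finset.card_univ, Fintype.card_fin,
      smul_eq_mul]
    rw [← Finset.mul_sum, hc']
  have e4 := Finset.sum_add_sum_compl (Finset.univ.image (rem T m)) (fun c => if P c then 1 else 0)
  rw [e3] at e4
  rw [e1]
  unfold kept
  omega

theorem stmt_15 (T m t : ℕ) (hT : 1 ≤ T) (hm : 2 ≤ m) (ht : 0 < t)
    (h : 2 * t + 1 = T * (2 ^ m - 1)) :
    ∀ k : ℕ, 0 < k →
      optRedundancy k t (fun u => hammingNorm u / T) ≤ 4 * t - m * T + 1 := by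
  intro k _
  obtain ⟨T, rfl⟩ : ∃ T', T = T' + 1 := ⟨T - 1, by omega⟩
  obtain ⟨m, rfl⟩ : ∃ m', m = m' + 1 := ⟨m - 1, by omega⟩
  have hD : 2 * t + 1 + (T+1) = (T+1) * 2^(m+1) := by
    have : 1 ≤ 2^(m+1) := Nat.one_le_two_pow
    obtain ⟨z, hz⟩ : ∃ z, 2^(m+1) = z + 1 := ⟨2^(m+1) - 1, by omega⟩
    rw [hz] at h ⊢
    simp only [Nat.add_sub_cancel] at h
    rw [h]; ring
  have hcard : (kept T m).card ≤ 4 * t - (m+1) * (T+1) + 1 := by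
    have := kept_card T m
    have h2 : 2 * (T+1) * 2^(m+1) = 2 * ((T+1) * 2^(m+1)) := by ring
    rw [h2, ← hD] at this
    omega
  refine le_trans (Nat.sInf_le ?_) hcard
  obtain ⟨g, h1, h2⟩ := gray_exists m
  let e := (kept T m).equivFin
  have main : ∀ u v : Fin k → ZMod 2, hammingNorm u / (T+1) < hammingNorm v / (T+1) →
      2 * t + 1 ≤ hammingDist u v + hammingDist (enc T m (g (hammingNorm u / (T+1))))
        (enc T m (g (hammingNorm v / (T+1)))) := by
    intro u v huv
    have htri : hammingNorm v ≤ hammingDist u v + hammingNorm u := by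
      have := hammingDist_triangle v u 0
      rwa [hammingDist_zero_right, hammingDist_zero_right, hammingDist_comm v u] at this
    have hu := Nat.div_add_mod (hammingNorm u) (T+1)
    have hu' := Nat.mod_lt (hammingNorm u) (Nat.succ_pos T)
    have hv := Nat.div_mul_le_self (hammingNorm v) (T+1)
    generalize hammingNorm u / (T+1) = a at *
    generalize hammingNorm v / (T+1) = b at *
    obtain ⟨d, rfl⟩ := Nat.exists_eq_add_of_lt huv
    have hd : d * (T+1) + 1 ≤ hammingDist u v := by
      simp only [Nat.succ_eq_add_one] at hu'
      nlinarith
    by_cases hg : g a = g (a+d+1)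
    · have h3 := (Nat.modEq_iff_dvd' (by omega)).1 (h2 _ _ hg)
      have h4 : 2^(m+1) ≤ d + 1 := by
        have := Nat.le_of_dvd (by omega) h3
        omega
      have := Nat.mul_le_mul_left (T+1) h4
      nlinarith
    · have h3 := enc_dist T m _ _ hg
      have h4 := Nat.mul_le_mul_left (T+1) (gray_dist g h1 a (d+1))
      rw [← add_assoc] at h4
      nlinarith
  refine ⟨fun u i => enc T m (g (hammingNorm u / (T+1))) (e.symm i), fun u v huv => ?_⟩
  have he : ∀ x y : kept T m → ZMod 2,
      hammingDist (fun i => x (e.symm i)) (fun i => y (e.symm i)) = hammingDist x y := by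
    intro x y
    simp only [hammingDist, Finset.card_filter]
    exact Equiv.sum_comp e.symm (fun i => if x i ≠ y i then 1 else 0)
  rw [he]
  rcases lt_or_gt_of_ne huv with hlt | hlt
  · exact main u v hlt
  · rw [hammingDist_comm u v, hammingDist_comm (enc T m _)]
    exact main v u hlt
end

section
/- Fix positive integers T and m. For a finite set A of natural numbers with |A| = m, let B(A) = ⋃_{a∈A} {aT, aT+1, …, aT+T−1} and let S(A) = ∑ |i−j| over all ordered pairs (i,j) ∈ B(A) × B(A) with ⌊i/T⌋ ≠ ⌊j/T⌋. Then for every such A, S(A) ≥ S({0, 1, …, m−1}); that is, S is minimized when A consists of m consecutive integers. -/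
/-- `Bset T A = ⋃_{a ∈ A} {aT, aT+1, …, aT+T-1}`. -/
def Bset (T : ℕ) (A : Finset ℕ) : Finset ℕ :=
  A.biUnion fun a => Finset.Ico (a * T) (a * T + T)

/-- `Ssum T A = ∑ |i - j|` over ordered pairs `(i,j) ∈ B(A) × B(A)` with `⌊i/T⌋ ≠ ⌊j/T⌋`. -/
def Ssum (T : ℕ) (A : Finset ℕ) : ℕ :=
  ∑ i ∈ Bset T A, ∑ j ∈ Bset T A, if i / T ≠ j / T then Nat.dist i j else 0

theorem sum_Bset_aux (T : ℕ) (hT : 0 < T) (A : Finset ℕ) (g : ℕ → ℕ) :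
    ∑ i ∈ Bset T A, g i = ∑ a ∈ A, ∑ r ∈ Finset.range T, g (a * T + r) := by
  unfold Bset
  rw [Finset.sum_biUnion]
  · refine Finset.sum_congr rfl fun a _ => ?_
    rw [Finset.sum_Ico_eq_sum_range]
    simp
  · intro a _ b _ hab
    rw [Function.onFun, Finset.disjoint_left]
    intro x hx hy
    rw [Finset.mem_Ico] at hx hy
    apply hab
    have h1 : x / T = a := Nat.div_eq_of_lt_le (by linarith) (by linarith)
    have h2 : x / T = b := Nat.div_eq_of_lt_le (by linarith) (by linarith)
    exact h1.symm.trans h2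

theorem Ssum_aux (T : ℕ) (hT : 0 < T) (A : Finset ℕ) :
    Ssum T A = ∑ a ∈ A, ∑ r ∈ Finset.range T, ∑ b ∈ A, ∑ s ∈ Finset.range T,
      if a ≠ b then Nat.dist (a * T + r) (b * T + s) else 0 := by
  unfold Ssum
  rw [sum_Bset_aux T hT]
  refine Finset.sum_congr rfl fun a _ => Finset.sum_congr rfl fun r hr => ?_
  rw [sum_Bset_aux T hT]
  refine Finset.sum_congr rfl fun b _ => Finset.sum_congr rfl fun s hs => ?_
  have key : ∀ c t : ℕ, t ∈ Finset.range T → (c * T + t) / T = c := by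
    intro c t ht
    rw [Finset.mem_range] at ht
    rw [mul_comm, Nat.mul_add_div hT, Nat.div_eq_of_lt ht, add_zero]
  rw [key a r hr, key b s hs]

theorem gap_aux {m : ℕ} (f : Fin m ↪o ℕ) (k l : Fin m) (h : k < l) :
    (l : ℕ) + f k ≤ f l + k := by
  have hsub : (Finset.Ico k l).map f.toEmbedding ⊆ Finset.Ico (f k) (f l) := by
    intro x hx
    simp only [Finset.mem_map, Finset.mem_Ico] at hx ⊢
    obtain ⟨y, ⟨h1, h2⟩, rfl⟩ := hx
    exact ⟨f.monotone h1, f.strictMono h2⟩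
  have := Finset.card_le_card hsub
  rw [Finset.card_map, Fin.card_Ico, Nat.card_Ico] at this
  have h3 : (k : ℕ) < l := h
  have h4 := f.strictMono h
  omega

theorem dist_aux {T k l a b r s : ℕ} (hr : r < T) (hs : s < T) (h : k < l)
    (hab : l + a ≤ b + k) :
    Nat.dist (k * T + r) (l * T + s) ≤ Nat.dist (a * T + r) (b * T + s) := by
  have h1 : (k + 1) * T ≤ l * T := Nat.mul_le_mul_right T h
  have h2 : (l + a) * T ≤ (b + k) * T := Nat.mul_le_mul_right T hab
  simp only [add_mul, one_mul] at h1 h2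
  unfold Nat.dist
  omega

theorem stmt_16 (T m : ℕ) (hT : 0 < T) (hm : 0 < m)
    (A : Finset ℕ) (hA : A.card = m) :
    Ssum T (Finset.range m) ≤ Ssum T A := by
  have hs : ∀ g : ℕ → ℕ, ∑ a ∈ A, g a = ∑ k : Fin m, g (A.orderEmbOfFin hA k) := by
    intro g
    conv_lhs => rw [← Finset.map_orderEmbOfFin_univ A hA]
    rw [Finset.sum_map]
    rfl
  rw [Ssum_aux T hT, Ssum_aux T hT]
  simp only [hs, Finset.sum_range (n := m)]
  refine Finset.sum_le_sum fun k _ => Finset.sum_le_sum fun r hr =>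
    Finset.sum_le_sum fun l _ => Finset.sum_le_sum fun s hs => ?_
  rw [Finset.mem_range] at hr hs
  rcases lt_trichotomy k l with h | h | h
  · have h3 : (k : ℕ) < l := h
    rw [if_pos h3.ne, if_pos ((A.orderEmbOfFin hA).strictMono h).ne]
    exact dist_aux hr hs h3 (gap_aux _ k l h)
  · subst h
    simp
  · have h3 : (l : ℕ) < k := h
    rw [if_pos h3.ne', if_pos ((A.orderEmbOfFin hA).strictMono h).ne',
      Nat.dist_comm, Nat.dist_comm (_ * T + r)]
    exact dist_aux hs hr h3 (gap_aux _ l k h)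
end
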